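/- Assume GRH. Then for every prime p with p ≥ 2.5·10^15 and ω(p−1) ≤ 6, the least prime primitive root modulo p satisfies ĝ(p) < √p − 2. -/

import Mathlib

/-- The Generalized Riemann Hypothesis: for every Dirichlet character `χ` (to any modulus),
every zero `s` of the Dirichlet L-function `L(s, χ)` with `0 < Re s < 1` has `Re s = 1/2`. -/
def GRH : Prop :=
  ∀ (N : ℕ) (_ : NeZero N) (χ : DirichletCharacter ℂ N) (s : ℂ),
    DirichletCharacter.LFunction χ s = 0 → 0 < s.re → s.re < 1 → s.re = 1 / 2

/-- The least prime `q` that is a primitive root modulo `p`. -/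
noncomputable def leastPrimePrimitiveRoot (p : ℕ) : ℕ :=
  sInf {q : ℕ | q.Prime ∧ orderOf (q : ZMod p) = p - 1}


section
open Complex Metric

theorem gw_disc (F : ℂ → ℂ) (hF : Differentiable ℂ F) (s0 : ℂ) (R M h : ℝ) (hM : 0 < M) (hh : 0 < h)
    (hR : 2 * h < R)
    (hnz : ∀ s ∈ ball s0 R, F s ≠ 0) (hb : ∀ s ∈ ball s0 R, ‖F s‖ ≤ Real.exp M * ‖F s0‖)
    (s : ℂ) (hs : ‖s - s0‖ ≤ R - 2 * h) :
    ‖deriv F s / F s‖ ≤ 2 * M * R / h / h ∧ Real.exp (-(2 * M * R / h)) * ‖F s0‖ ≤ ‖F s‖ := by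
  have hR0 : 0 < R := by linarith
  have hs0 : s0 ∈ ball s0 R := mem_ball_self hR0
  have hd : DifferentiableOn ℂ (fun z => deriv F z / F z) (ball s0 R) := by
    apply DifferentiableOn.div
    · exact (hF.deriv).differentiableOn
    · exact hF.differentiableOn
    · exact hnz
  obtain ⟨g, hg0, hg⟩ := hd.isExactOn_ball.with_val_at s0 0
  -- exp g * F s0 = F
  have key : ∀ z ∈ ball s0 R, F z = F s0 * exp (g z) := by
    have hdiff : ∀ z ∈ ball s0 R, HasDerivAt (fun w => F w * exp (-g w)) 0 z := by
      intro z hz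
      have h1 := (hF z).hasDerivAt.mul ((hg z hz).neg.cexp)
      refine h1.congr_deriv ?_
      have := hnz z hz
      field_simp
      ring
    intro z hz
    have hc : F z * exp (-g z) = F s0 * exp (-g s0) := by
      apply (convex_ball s0 R).is_const_of_fderivWithin_eq_zero (𝕜 := ℂ)
        (f := fun w => F w * exp (-g w)) _ _ hz hs0
      · intro w hw; exact (hdiff w hw).differentiableAt.differentiableWithinAt
      · intro w hw
        rw [fderivWithin_of_isOpen isOpen_ball hw]
        have := (hdiff w hw).hasFDerivAt.fderiv
        rw [this]; ext; simp
    rw [hg0, neg_zero, exp_zero, mul_one] at hc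
    rw [← hc, mul_assoc, ← exp_add]; simp
  have hF0 : 0 < ‖F s0‖ := norm_pos_iff.mpr (hnz s0 hs0)
  have hre : ∀ z ∈ ball s0 R, (g z).re ≤ M := by
    intro z hz
    have h1 := hb z hz
    rw [key z hz, norm_mul, norm_exp, mul_comm] at h1
    have := le_of_mul_le_mul_right h1 hF0
    exact Real.exp_le_exp.mp this
  have hbc : ∀ z, ‖z - s0‖ ≤ R - h → ‖g z‖ ≤ 2 * M * R / h := by
    intro z hz
    have := borelCaratheodory_zero (f := fun w => g (s0 + w)) (z := z - s0) hM
      (R := R) ?_ ?_ hR0 ?_ ?_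
    · simp only [add_sub_cancel] at this
      refine this.trans ?_
      gcongr
      · linarith
      · linarith
    · intro w hw
      have hw' : s0 + w ∈ ball s0 R := by simpa using hw
      have := (hg _ hw').comp_const_add s0 w
      exact this.differentiableAt.differentiableWithinAt
    · intro w hw
      have hw' : s0 + w ∈ ball s0 R := by simpa using hw
      exact hre _ hw'
    · simp; linarith
    · simpa using hg0
  have hsb : s ∈ ball s0 R := by simp [dist_eq_norm]; linarith
  constructor
  · rw [← (hg s hsb).deriv]
    apply norm_deriv_le_of_forall_mem_sphere_norm_le hh
    · refine DifferentiableOn.diffContOnCl ?_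
      intro w hw
      rw [closure_ball _ hh.ne'] at hw
      have : w ∈ ball s0 R := by
        simp only [mem_closedBall, mem_ball] at *
        have := dist_triangle w s s0
        rw [dist_eq_norm s s0] at this
        linarith
      exact (hg w this).differentiableAt.differentiableWithinAt
    · intro w hw
      apply hbc
      simp only [mem_sphere] at hw
      have := dist_triangle w s s0
      rw [dist_eq_norm s s0, dist_eq_norm w s0] at this
      linarith
  · rw [key s hsb, norm_mul, norm_exp, mul_comm]
    gcongr
    have h1 := hbc s (by linarith)
    have h2 := abs_re_le_norm (g s)
    have h3 := neg_abs_le (g s).re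
    linarith

theorem gw_growth (F : ℂ → ℂ) (hF : Differentiable ℂ F) (hnz : ∀ s : ℂ, 1/2 < s.re → F s ≠ 0)
    (A c : ℝ) (hc : 0 < c) (hA : ∀ s : ℂ, 1/4 ≤ s.re → ‖F s‖ ≤ A * (1 + ‖s‖))
    (hl : ∀ s : ℂ, 3/2 ≤ s.re → c ≤ ‖F s‖) (η : ℝ) (hη : 0 < η) (hη' : η < 1/2) :
    ∃ C > 0, ∀ s : ℂ, 1/2 + η ≤ s.re → s.re ≤ 2 →
      ‖deriv F s / F s‖ ≤ C * √(1 + ‖s‖) ∧ Real.exp (-(C * √(1 + ‖s‖))) ≤ ‖F s‖ := by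
  have hA0 : 0 < A := by
    have h1 := hA 2 (by norm_num)
    have h2 := hl 2 (by norm_num)
    norm_num at h1
    nlinarith
  -- M
  set K : ℝ := (|Real.log (A / c)| + 8) with hK
  have hKpos : 0 < K := by positivity
  set L : ℝ := 2 * K * (3/2) / (η/4) with hL
  have hLpos : 0 < L := by positivity
  refine ⟨L / (η/4) + L + |Real.log c|, by positivity, ?_⟩
  intro s hs1 hs2
  set s0 : ℂ := ⟨2, s.im⟩ with hs0
  have hs00 : ‖s0‖ ≤ 2 + ‖s‖ := by
    have h1 : s0 = (2 - s.re : ℝ) + s := by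
      apply Complex.ext <;> simp [hs0]
    rw [h1]
    refine (norm_add_le _ _).trans ?_
    rw [norm_real]
    have : ‖(2 - s.re : ℝ)‖ ≤ 2 := by
      rw [Real.norm_eq_abs, abs_le]; constructor <;> linarith
    linarith
  have hsq1 : 1 ≤ √(1 + ‖s‖) := by
    rw [Real.one_le_sqrt]; linarith [norm_nonneg s]
  have hsq : √(1 + ‖s‖) ^ 2 = 1 + ‖s‖ := Real.sq_sqrt (by positivity)
  have hR : ∀ w ∈ ball s0 (3/2 - η/2), 1/2 < w.re := by
    intro w hw
    rw [mem_ball, dist_eq_norm] at hw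
    have h1 := abs_re_le_norm (w - s0)
    have h2 := neg_abs_le (w - s0).re
    simp [hs0] at h1 h2
    simp only [hs0] at hw
    linarith
  have := gw_disc F hF s0 (3/2 - η/2) (K * √(1 + ‖s‖)) (η/4) (by positivity) (by positivity)
    (by linarith) (fun w hw => hnz w (hR w hw)) ?_ s ?_
  · have hlow := hl s0 (by simp [hs0]; norm_num)
    have hstep : 2 * (K * √(1 + ‖s‖)) * (3/2 - η/2) / (η/4) ≤ L * √(1 + ‖s‖) := by
      rw [hL]
      have : 2 * K * (3/2) / (η/4) * √(1 + ‖s‖) = 2 * (K * √(1 + ‖s‖)) * (3/2) / (η/4) := by ring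
      rw [this]
      gcongr
      linarith
    constructor
    · refine this.1.trans ?_
      calc 2 * (K * √(1 + ‖s‖)) * (3/2 - η/2) / (η/4) / (η/4) ≤ L * √(1 + ‖s‖) / (η/4) := by gcongr
        _ = L / (η/4) * √(1 + ‖s‖) := by ring
        _ ≤ _ := by gcongr; linarith [abs_nonneg (Real.log c)]
    · refine le_trans ?_ this.2
      have hc' : c = Real.exp (Real.log c) := (Real.exp_log hc).symm
      calc Real.exp (-((L / (η/4) + L + |Real.log c|) * √(1 + ‖s‖)))
          ≤ Real.exp (-(L * √(1 + ‖s‖)) + Real.log c) := by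
            gcongr
            have h1 := neg_abs_le (Real.log c)
            have h2 : 0 ≤ L / (η/4) * √(1 + ‖s‖) := by positivity
            nlinarith [abs_nonneg (Real.log c)]
        _ = Real.exp (-(L * √(1 + ‖s‖))) * c := by rw [Real.exp_add, Real.exp_log hc]
        _ ≤ _ := by gcongr
  · intro w hw
    have hlow := hl s0 (by simp [hs0]; norm_num)
    have hw1 := hA w (by linarith [hR w hw])
    rw [mem_ball, dist_eq_norm] at hw
    have hw2 : ‖w‖ ≤ 7/2 + ‖s‖ := by
      have := norm_add_le (w - s0) s0
      simp only [sub_add_cancel] at this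
      linarith
    have h5 : ‖F w‖ ≤ A * (5 * √(1 + ‖s‖) ^ 2) := by
      rw [hsq]
      refine hw1.trans ?_
      gcongr
      linarith [norm_nonneg s]
    have h6 : 5 * √(1 + ‖s‖) ^ 2 ≤ Real.exp (8 * √(1 + ‖s‖)) := by
      have h7 := Real.add_one_le_exp (4 * √(1 + ‖s‖))
      have h8 : Real.exp (8 * √(1 + ‖s‖)) = Real.exp (4 * √(1 + ‖s‖)) ^ 2 := by
        rw [← Real.exp_nat_mul]; congr 1; push_cast; ring
      rw [h8]
      nlinarith
    calc ‖F w‖ ≤ A * Real.exp (8 * √(1 + ‖s‖)) := h5.trans (by gcongr)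
      _ = (A / c) * Real.exp (8 * √(1 + ‖s‖)) * c := by field_simp
      _ ≤ Real.exp (|Real.log (A / c)| * √(1 + ‖s‖)) * Real.exp (8 * √(1 + ‖s‖)) * ‖F s0‖ := by
          gcongr
          calc A / c = Real.exp (Real.log (A / c)) := (Real.exp_log (by positivity)).symm
            _ ≤ _ := by
              gcongr
              have := le_abs_self (Real.log (A / c))
              nlinarith [abs_nonneg (Real.log (A / c))]
      _ = _ := by rw [← Real.exp_add, hK]; ring_nf
  · have : s - s0 = ((s.re - 2 : ℝ) : ℂ) := by
      apply Complex.ext <;> simp [hs0]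
    rw [this, norm_real, Real.norm_eq_abs, abs_le]
    constructor <;> linarith

end

section
open Complex Filter Topology

theorem gw_phi_conv (y : ℝ) : ConvexOn ℝ (Set.Ioi 0) (fun v : ℝ => Real.log (1 + y^2/v^2)) := by
  have hd : ∀ v ∈ Set.Ioi (0:ℝ), HasDerivAt (fun v : ℝ => Real.log (1 + y^2/v^2))
      (-(2 * y^2) / (v * (v^2 + y^2))) v := by
    intro v hv
    have hv : 0 < v := hv
    have h1 : HasDerivAt (fun v : ℝ => 1 + y^2/v^2) (-(2*y^2)/v^3) v := by
      have := (((hasDerivAt_id v).pow 2).inv (by simp; positivity)).const_mul (y^2) |>.const_add 1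
      refine this.congr_deriv ?_
      simp only [id, Pi.pow_apply, Nat.cast_ofNat, Nat.add_one_sub_one, pow_one]
      field_simp
    have h2 := h1.log (by positivity)
    convert h2 using 1
    field_simp
  apply MonotoneOn.convexOn_of_deriv (convex_Ioi 0)
  · intro v hv; exact (hd v hv).continuousAt.continuousWithinAt
  · rw [interior_Ioi]; intro v hv; exact (hd v hv).differentiableAt.differentiableWithinAt
  · rw [interior_Ioi]
    intro a ha b hb hab
    have ha : 0 < a := ha
    have hb' : 0 < b := hb
    rw [(hd a ha).deriv, (hd b hb).deriv, neg_div, neg_div]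
    apply neg_le_neg
    gcongr

theorem gw_step_log (x y δ : ℝ) (hx : 1 < x) (h0 : 0 < δ) (h1 : δ ≤ 1) :
    Real.log x + 1/2 * Real.log (1 + y^2/x^2) + δ * (Real.log (x+1) + 1/2 * Real.log (1 + y^2/x^2)) ≤
    Real.log (x+δ) + 1/2 * Real.log (1 + y^2/(x+δ)^2) +
      δ * (Real.log x + 1/2 * Real.log (1 + y^2/(x-1)^2)) := by
  have hc := (gw_phi_conv y).2 (show x - 1 ∈ Set.Ioi 0 by simp; linarith) (show x + δ ∈ Set.Ioi 0 by simp; linarith)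
    (show 0 ≤ δ/(1+δ) by positivity) (show 0 ≤ 1/(1+δ) by positivity) (by field_simp; ring)
  have e : (δ/(1+δ)) • (x-1) + (1/(1+δ)) • (x+δ) = x := by
    simp only [smul_eq_mul]; field_simp; ring
  rw [e] at hc
  simp only [smul_eq_mul] at hc
  have hc2 : (1+δ) * Real.log (1 + y^2/x^2) ≤ δ * Real.log (1 + y^2/(x-1)^2) + Real.log (1 + y^2/(x+δ)^2) := by
    have h3 := mul_le_mul_of_nonneg_left hc (show 0 ≤ 1 + δ by linarith)
    refine h3.trans (le_of_eq ?_)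
    have : (1 + δ) ≠ 0 := by positivity
    generalize Real.log (1 + y^2/(x-1)^2) = P
    generalize Real.log (1 + y^2/(x+δ)^2) = Q
    field_simp
  have hb : δ * (Real.log (x+1) - Real.log x) ≤ Real.log (x+δ) - Real.log x := by
    rw [← Real.log_div (by linarith) (by linarith), ← Real.log_div (by linarith) (by linarith),
      ← Real.log_rpow (by positivity)]
    apply Real.log_le_log (by positivity)
    have hx0 : 0 ≤ 1/x := by positivity
    have := rpow_one_add_le_one_add_mul_self (s := 1/x) (p := δ) (by linarith) h0.le h1
    have e1 : (x+1)/x = 1 + 1/x := by field_simp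
    have e2 : (x+δ)/x = 1 + δ * (1/x) := by field_simp
    rw [e1, e2]; exact this
  linarith

theorem gw_log_norm (z : ℂ) (hz : 0 < z.re) :
    Real.log ‖z‖ = Real.log z.re + 1/2 * Real.log (1 + z.im^2/z.re^2) := by
  have : ‖z‖^2 = z.re^2 * (1 + z.im^2/z.re^2) := by
    rw [Complex.sq_norm, normSq_apply]; field_simp
  have h2 : 2 * Real.log ‖z‖ = 2 * Real.log z.re + Real.log (1 + z.im^2/z.re^2) := by
    have h3 := congrArg Real.log this
    rw [Real.log_mul (by positivity) (by positivity), Real.log_pow, Real.log_pow] at h3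
    exact_mod_cast h3
  linarith

noncomputable def gwW (z : ℂ) : ℝ := z.re * √(1 + z.im^2/(z.re-1)^2)

theorem gwW_pos (z : ℂ) (hz : 1 < z.re) : 0 < gwW z := by unfold gwW; positivity

theorem gwW_ge (z : ℂ) (hz : 1 < z.re) : z.re ≤ gwW z := by
  unfold gwW
  have : 1 ≤ √(1 + z.im^2/(z.re-1)^2) := by
    rw [Real.one_le_sqrt]; have : 0 ≤ z.im^2/(z.re-1)^2 := by positivity
    linarith
  nlinarith

theorem gw_step (z : ℂ) (δ : ℝ) (hz : 1 < z.re) (h0 : 0 < δ) (h1 : δ ≤ 1) :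
    ‖z‖ * gwW (z+1) ^ δ ≤ ‖z + δ‖ * gwW z ^ δ := by
  have p1 : 0 < gwW z := gwW_pos z hz
  have p2 : 0 < gwW (z+1) := gwW_pos _ (by simp; linarith)
  have n1 : 0 < ‖z‖ := norm_pos_iff.mpr (by rintro rfl; simp at hz; linarith)
  have n2 : 0 < ‖z+δ‖ := norm_pos_iff.mpr (by intro h; have := congrArg re h; simp at this; linarith)
  rw [← Real.log_le_log_iff (by positivity) (by positivity), Real.log_mul (by positivity) (by positivity),
    Real.log_mul (by positivity) (by positivity), Real.log_rpow p2, Real.log_rpow p1,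
    gw_log_norm z (by linarith), gw_log_norm (z+δ) (by simp; linarith)]
  unfold gwW
  rw [Real.log_mul (by simp; linarith) (by positivity), Real.log_mul (by linarith) (by positivity),
    Real.log_sqrt (by positivity), Real.log_sqrt (by positivity)]
  simp only [add_re, one_re, add_im, one_im, ofReal_re, ofReal_im, add_zero, add_sub_cancel_right]
  have := gw_step_log z.re z.im δ hz h0 h1
  linarith

theorem gw_prod (z : ℂ) (δ : ℝ) (hz : 1 < z.re) (h0 : 0 < δ) (h1 : δ ≤ 1) (n : ℕ) :
    (∏ j ∈ Finset.range n, ‖z + j‖) * gwW (z + n) ^ δ ≤ (∏ j ∈ Finset.range n, ‖z + δ + j‖) * gwW z ^ δ := by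
  induction n with
  | zero => simp
  | succ n ih =>
    rw [Finset.prod_range_succ, Finset.prod_range_succ]
    have := gw_step (z + n) δ (by simp; linarith [Nat.cast_nonneg (α := ℝ) n]) h0 h1
    have e : z + n + 1 = z + (n+1 : ℕ) := by push_cast; ring
    have e2 : z + n + δ = z + δ + n := by ring
    rw [e, e2] at this
    calc (∏ j ∈ Finset.range n, ‖z + j‖) * ‖z + n‖ * gwW (z + (n+1 : ℕ)) ^ δ
        = (∏ j ∈ Finset.range n, ‖z + j‖) * (‖z + n‖ * gwW (z + (n+1 : ℕ)) ^ δ) := by ring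
      _ ≤ (∏ j ∈ Finset.range n, ‖z + j‖) * (‖z + δ + n‖ * gwW (z + n) ^ δ) := by
          gcongr
      _ = ((∏ j ∈ Finset.range n, ‖z + j‖) * gwW (z + n) ^ δ) * ‖z + δ + n‖ := by ring
      _ ≤ ((∏ j ∈ Finset.range n, ‖z + δ + j‖) * gwW z ^ δ) * ‖z + δ + n‖ := by gcongr
      _ = _ := by ring

theorem gw_gamma_one (z : ℂ) (δ : ℝ) (hz : 1 < z.re) (h0 : 0 < δ) (h1 : δ ≤ 1) :
    ‖Gamma (z + δ)‖ ≤ gwW z ^ δ * ‖Gamma z‖ := by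
  have t1 := (GammaSeq_tendsto_Gamma (z + δ)).norm
  have t2 := ((GammaSeq_tendsto_Gamma z).norm).const_mul (gwW z ^ δ)
  refine le_of_tendsto_of_tendsto t1 t2 ?_
  filter_upwards [eventually_gt_atTop 0] with n hn
  have hn' : (0:ℝ) < n := by exact_mod_cast hn
  unfold GammaSeq
  rw [norm_div, norm_div, norm_mul, norm_mul, norm_prod, norm_prod]
  rw [norm_natCast_cpow_of_pos hn, norm_natCast_cpow_of_pos hn]
  have P := gw_prod z δ hz h0 h1 (n+1)
  have pp1 : 0 < ∏ j ∈ Finset.range (n+1), ‖z + j‖ := by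
    apply Finset.prod_pos; intro j _
    apply norm_pos_iff.mpr; intro h; have := congrArg re h; simp at this
    linarith [Nat.cast_nonneg (α := ℝ) j]
  have pp2 : 0 < ∏ j ∈ Finset.range (n+1), ‖z + δ + j‖ := by
    apply Finset.prod_pos; intro j _
    apply norm_pos_iff.mpr; intro h; have := congrArg re h; simp at this
    linarith [Nat.cast_nonneg (α := ℝ) j]
  have hW : (n:ℝ) ^ δ ≤ gwW (z + (n+1 : ℕ)) ^ δ := by
    apply Real.rpow_le_rpow hn'.le _ h0.le
    have := gwW_ge (z + (n+1 : ℕ)) (by simp; linarith)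
    simp at this
    push_cast
    linarith
  rw [← mul_div_assoc, div_le_div_iff₀ pp2 pp1]
  simp only [add_re, ofReal_re]
  rw [Real.rpow_add hn']
  calc (n:ℝ) ^ z.re * (n:ℝ) ^ δ * ‖(n.factorial : ℂ)‖ * ∏ j ∈ Finset.range (n+1), ‖z + j‖
      ≤ (n:ℝ) ^ z.re * gwW (z + (n+1 : ℕ)) ^ δ * ‖(n.factorial : ℂ)‖ * ∏ j ∈ Finset.range (n+1), ‖z + j‖ := by
        gcongr
    _ = (n:ℝ) ^ z.re * ‖(n.factorial : ℂ)‖ * ((∏ j ∈ Finset.range (n+1), ‖z + j‖) * gwW (z + (n+1 : ℕ)) ^ δ) := by ring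
    _ ≤ (n:ℝ) ^ z.re * ‖(n.factorial : ℂ)‖ * ((∏ j ∈ Finset.range (n+1), ‖z + δ + j‖) * gwW z ^ δ) := by gcongr
    _ = _ := by ring

theorem gw_gamma_rec (z : ℂ) (δ C : ℝ) (hz : 0 < z.re) (h0 : 0 < δ)
    (h : ‖Gamma (z + 1 + δ)‖ ≤ C * ‖Gamma (z + 1)‖) : ‖Gamma (z + δ)‖ ≤ C * ‖Gamma z‖ := by
  have z0 : z ≠ 0 := by rintro rfl; simp at hz
  have z1 : z + δ ≠ 0 := by intro h; have := congrArg re h; simp at this; linarith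
  have e : z + 1 + δ = z + δ + 1 := by ring
  rw [e, Gamma_add_one _ z0, Gamma_add_one _ z1, norm_mul, norm_mul] at h
  have hn : ‖z‖ ≤ ‖z + δ‖ := by
    rw [Complex.norm_def, Complex.norm_def]
    apply Real.sqrt_le_sqrt
    rw [normSq_apply, normSq_apply]; simp; nlinarith
  have p : 0 < ‖z‖ := norm_pos_iff.mpr z0
  have : ‖z‖ * ‖Gamma (z + δ)‖ ≤ ‖z‖ * (C * ‖Gamma z‖) := by
    calc _ ≤ ‖z + δ‖ * ‖Gamma (z + δ)‖ := by gcongr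
      _ ≤ _ := h
      _ = _ := by ring
  exact le_of_mul_le_mul_left this p

theorem gw_gamma_upper (z : ℂ) (δ : ℝ) (hz : 0 < z.re) (h0 : 0 < δ) (h1 : δ ≤ 1) :
    ‖Gamma (z + δ)‖ ≤ (2 * ‖z + 1‖) ^ δ * ‖Gamma z‖ := by
  apply gw_gamma_rec z δ _ hz h0
  apply gw_gamma_rec (z+1) δ _ (by simp; linarith) h0
  refine (gw_gamma_one (z+1+1) δ (by simp; linarith) h0 h1).trans ?_
  gcongr
  · exact (gwW_pos _ (by simp; linarith)).le
  · unfold gwW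
    have hx : 0 < z.re + 1 := by linarith
    have e : ‖z + 1‖ = (z.re + 1) * √(1 + z.im^2/(z.re+1)^2) := by
      rw [Complex.norm_def, normSq_apply]
      simp only [add_re, one_re, add_im, one_im, add_zero]
      have : (z.re + 1) * (z.re + 1) + z.im * z.im = (z.re + 1)^2 * (1 + z.im^2/(z.re+1)^2) := by
        field_simp
      rw [this, Real.sqrt_mul (by positivity), Real.sqrt_sq hx.le]
    rw [e]
    simp only [add_re, one_re, add_im, one_im, add_zero, add_sub_cancel_right]
    have : 0 ≤ √(1 + z.im^2/(z.re+1)^2) := by positivity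
    nlinarith

theorem gw_gamma_lower (δ : ℝ) (h0 : 0 < δ) : ∃ K > 0, ∀ z : ℂ, 1/8 ≤ z.re →
    ‖Gamma z‖ ≤ K * ‖Gamma (z + δ)‖ := by
  have hG : 0 < ‖Gamma (δ : ℂ)‖ := norm_pos_iff.mpr (Gamma_ne_zero_of_re_pos (by simpa))
  set K := ∫ x in (0:ℝ)..1, ‖(x:ℂ) ^ (((1/8:ℝ):ℂ) - 1) * (1 - x) ^ ((δ:ℂ) - 1)‖ with hK
  have hIntg : IntervalIntegrable (fun x : ℝ => ‖(x:ℂ) ^ (((1/8:ℝ):ℂ) - 1) * (1 - x) ^ ((δ:ℂ) - 1)‖) MeasureTheory.volume 0 1 :=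
    (betaIntegral_convergent (u := ((1/8:ℝ):ℂ)) (v := (δ:ℂ)) (by simp) (by simpa)).norm
  have hK0 : 0 ≤ K := intervalIntegral.integral_nonneg (by norm_num) (fun x _ => norm_nonneg _)
  refine ⟨(K + 1) / ‖Gamma (δ:ℂ)‖, by positivity, ?_⟩
  intro z hz
  have h := Gamma_mul_Gamma_eq_betaIntegral (s := z) (t := (δ:ℂ)) (by linarith) (by simpa)
  have hb : ‖betaIntegral z δ‖ ≤ K := by
    unfold betaIntegral
    rw [hK]
    apply intervalIntegral.norm_integral_le_of_norm_le (by norm_num) _ hIntg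
    filter_upwards with x hx
    rw [norm_mul, norm_mul]
    gcongr
    rw [norm_cpow_eq_rpow_re_of_pos hx.1, norm_cpow_eq_rpow_re_of_pos hx.1]
    apply Real.rpow_le_rpow_of_exponent_ge hx.1 hx.2
    simp only [sub_re, ofReal_re, one_re]
    linarith
  have h2 := congrArg norm h
  rw [norm_mul, norm_mul] at h2
  rw [div_mul_eq_mul_div, le_div_iff₀ hG, h2]
  nlinarith [norm_nonneg (Gamma (z + δ))]

end

section
open Complex Filter Topology Bornology

theorem gw_diffGamma (z : ℂ) (hz : 0 < z.re) : DifferentiableAt ℂ Gamma z := by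
  apply differentiableAt_Gamma
  intro m h
  have := congrArg re h
  simp at this
  linarith [Nat.cast_nonneg (α := ℝ) m]

theorem gw_PL (F : ℂ → ℂ) (hF : Differentiable ℂ F) (hnz : ∀ s : ℂ, 1/2 < s.re → F s ≠ 0)
    (A c A2 : ℝ) (hc : 0 < c) (hA : ∀ s : ℂ, 1/4 ≤ s.re → ‖F s‖ ≤ A * (1 + ‖s‖))
    (hl : ∀ s : ℂ, 3/2 ≤ s.re → c ≤ ‖F s‖) (hu : ∀ s : ℂ, 3/2 ≤ s.re → ‖F s‖ ≤ A2)
    (a k : ℝ) (ha : 0 < a) (hk : 0 ≤ k) (δ : ℝ) (hδ : 0 < δ) (hδ' : δ < 1/4)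
    (hfe : ∀ t : ℝ, ‖Gamma ((1/2 + t * I - δ + k)/2)‖ * ‖F (1/2 + t * I - δ)‖ =
      a ^ δ * (‖Gamma ((1/2 + t * I + δ + k)/2)‖ * ‖F (1/2 + t * I + δ)‖))
    (s : ℂ) (hs : 1/2 ≤ s.re) :
    ‖F (s - δ)‖ ≤ (a * ‖s - δ + k + 2‖) ^ δ * ‖F (s + δ)‖ := by
  have hA0 : 0 < A := by
    have h1 := hA 2 (by norm_num)
    have h2 := hl 2 (by norm_num)
    norm_num at h1
    nlinarith
  have hA20 : 0 < A2 := lt_of_lt_of_le hc ((hl 2 (by norm_num)).trans (hu 2 (by norm_num)))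
  obtain ⟨C, hC, hCb⟩ := gw_growth F hF hnz A c hc hA hl δ hδ (by linarith)
  obtain ⟨K, hK, hKb⟩ := gw_gamma_lower δ hδ
  set f : ℂ → ℂ := fun z => Gamma ((1/2 + z - δ + k)/2) / Gamma ((1/2 + z + δ + k)/2) *
    (F (1/2 + z - δ) / F (1/2 + z + δ)) with hf
  have hre1 : ∀ z : ℂ, ((1/2 + z - δ + k)/2).re = (1/2 + z.re - δ + k)/2 := by
    intro z; simp
  have hre2 : ∀ z : ℂ, ((1/2 + z + δ + k)/2).re = (1/2 + z.re + δ + k)/2 := by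
    intro z; simp
  have hG2 : ∀ z : ℂ, 0 ≤ z.re → Gamma ((1/2 + z + δ + k)/2) ≠ 0 := by
    intro z hz; apply Gamma_ne_zero_of_re_pos; rw [hre2]; linarith
  have hG1 : ∀ z : ℂ, 0 ≤ z.re → Gamma ((1/2 + z - δ + k)/2) ≠ 0 := by
    intro z hz; apply Gamma_ne_zero_of_re_pos; rw [hre1]; linarith
  have hF2 : ∀ z : ℂ, 0 ≤ z.re → F (1/2 + z + δ) ≠ 0 := by
    intro z hz; apply hnz; simp; linarith
  have hGb : ∀ z : ℂ, 0 ≤ z.re →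
      ‖Gamma ((1/2 + z - δ + k)/2) / Gamma ((1/2 + z + δ + k)/2)‖ ≤ K := by
    intro z hz
    rw [norm_div, div_le_iff₀ (norm_pos_iff.mpr (hG2 z hz))]
    have := hKb ((1/2 + z - δ + k)/2) (by rw [hre1]; linarith)
    have e : (1/2 + z - δ + k)/2 + δ = (1/2 + z + δ + k)/2 := by ring
    rwa [e] at this
  have hcl : closure {z : ℂ | 0 < z.re} ⊆ {z : ℂ | 0 ≤ z.re} :=
    closure_minimal (fun z (hz : 0 < z.re) => show 0 ≤ z.re from hz.le) (isClosed_le continuous_const continuous_re)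
  have hd : DiffContOnCl ℂ f {z : ℂ | 0 < z.re} := by
    apply DifferentiableOn.diffContOnCl
    intro z hz
    have hz := hcl hz
    simp only [Set.mem_setOf_eq] at hz
    apply DifferentiableAt.differentiableWithinAt
    have d1 : DifferentiableAt ℂ (fun z : ℂ => Gamma ((1/2 + z - δ + k)/2)) z := by
      apply DifferentiableAt.comp z (g := Gamma) (f := fun z : ℂ => (1/2 + z - δ + k)/2)
      · apply gw_diffGamma; rw [hre1]; linarith
      · fun_prop
    have d2 : DifferentiableAt ℂ (fun z : ℂ => Gamma ((1/2 + z + δ + k)/2)) z := by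
      apply DifferentiableAt.comp z (g := Gamma) (f := fun z : ℂ => (1/2 + z + δ + k)/2)
      · apply gw_diffGamma; rw [hre2]; linarith
      · fun_prop
    have d3 : DifferentiableAt ℂ (fun z : ℂ => F (1/2 + z - δ)) z := by
      apply DifferentiableAt.comp z (g := F) (f := fun z : ℂ => 1/2 + z - δ)
      · exact hF _
      · fun_prop
    have d4 : DifferentiableAt ℂ (fun z : ℂ => F (1/2 + z + δ)) z := by
      apply DifferentiableAt.comp z (g := F) (f := fun z : ℂ => 1/2 + z + δ)
      · exact hF _
      · fun_prop
    exact (d1.div d2 (hG2 z hz)).mul (d3.div d4 (hF2 z hz))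
  have him : ∀ t : ℝ, ‖f (t * I)‖ ≤ a ^ δ := by
    intro t
    simp only [hf]
    have h := hfe t
    have p1 := norm_pos_iff.mpr (hG2 (t * I) (by simp))
    have p2 := norm_pos_iff.mpr (hF2 (t * I) (by simp))
    rw [norm_mul, norm_div, norm_div, div_mul_div_comm, h, mul_div_assoc, div_self (by positivity), mul_one]
  have hnz1 : ∀ z : ℂ, ‖1/2 + z - δ‖ ≤ 1 + ‖z‖ := by
    intro z
    have : (1/2 + z - δ : ℂ) = ((1/2 - δ : ℝ) : ℂ) + z := by push_cast; ring
    rw [this]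
    refine (norm_add_le _ _).trans ?_
    gcongr
    rw [norm_real, Real.norm_eq_abs, abs_le]; constructor <;> linarith
  have hnz2 : ∀ z : ℂ, ‖1/2 + z + δ‖ ≤ 1 + ‖z‖ := by
    intro z
    have : (1/2 + z + δ : ℂ) = ((1/2 + δ : ℝ) : ℂ) + z := by push_cast; ring
    rw [this]
    refine (norm_add_le _ _).trans ?_
    gcongr
    rw [norm_real, Real.norm_eq_abs, abs_le]; constructor <;> linarith
  have hlow : ∀ z : ℂ, 0 ≤ z.re → ‖F (1/2 + z + δ)‖⁻¹ ≤ (1 + 1/c) * Real.exp (C * (2 + ‖z‖)) := by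
    intro z hz
    have he1 : 1 ≤ Real.exp (C * (2 + ‖z‖)) := Real.one_le_exp (by positivity)
    have hc' : 0 < 1/c := by positivity
    rcases le_total (1/2 + z + δ : ℂ).re 2 with h | h
    · have := (hCb (1/2 + z + δ) (by simp; linarith) h).2
      have h3 : ‖F (1/2 + z + δ)‖⁻¹ ≤ Real.exp (C * √(1 + ‖1/2 + z + δ‖)) := by
        rw [inv_le_comm₀ (norm_pos_iff.mpr (hF2 z hz)) (Real.exp_pos _), ← Real.exp_neg]
        exact this
      have h4 : √(1 + ‖1/2 + z + δ‖) ≤ 2 + ‖z‖ := by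
        rw [Real.sqrt_le_left (by positivity)]
        have := hnz2 z
        nlinarith [norm_nonneg z]
      calc _ ≤ _ := h3
        _ ≤ Real.exp (C * (2 + ‖z‖)) := by gcongr
        _ ≤ _ := by nlinarith
    · have := hl (1/2 + z + δ) (by linarith)
      calc _ ≤ c⁻¹ := by gcongr
        _ = 1/c := by ring
        _ ≤ _ := by nlinarith
  have hexp : ∃ d < (2 : ℝ), ∃ B,
      f =O[cobounded ℂ ⊓ 𝓟 {z | 0 < z.re}] fun z => Real.exp (B * ‖z‖ ^ d) := by
    refine ⟨1, by norm_num, 1 + C, ?_⟩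
    apply Asymptotics.IsBigO.of_bound (K * (A * Real.exp 2) * ((1 + 1/c) * Real.exp (2 * C)))
    apply Filter.Eventually.filter_mono inf_le_right
    rw [eventually_principal]
    intro z hz
    have hz : 0 ≤ z.re := le_of_lt hz
    rw [Real.rpow_one, Real.norm_eq_abs, abs_of_pos (Real.exp_pos _)]
    simp only [hf]
    rw [norm_mul, norm_div (F _), div_eq_mul_inv ‖F _‖]
    have h1 : ‖F (1/2 + z - δ)‖ ≤ A * Real.exp 2 * Real.exp ‖z‖ := by
      refine (hA _ (by simp; linarith)).trans ?_
      rw [mul_assoc, ← Real.exp_add]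
      gcongr
      have := hnz1 z
      have := Real.add_one_le_exp (2 + ‖z‖)
      linarith
    calc _ ≤ K * ((A * Real.exp 2 * Real.exp ‖z‖) * ((1 + 1/c) * Real.exp (C * (2 + ‖z‖)))) := by
          gcongr
          · exact hGb z hz
          · exact hlow z hz
      _ = K * (A * Real.exp 2) * (1 + 1/c) * (Real.exp ‖z‖ * Real.exp (C * (2 + ‖z‖))) := by ring
      _ = K * (A * Real.exp 2) * (1 + 1/c) * (Real.exp (2*C) * Real.exp ((1+C) * ‖z‖)) := by
          rw [← Real.exp_add, ← Real.exp_add]; ring_nf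
      _ = _ := by ring
  have hre : IsBoundedUnder (· ≤ ·) atTop fun x : ℝ => ‖f x‖ := by
    refine ⟨K * (A2 * c⁻¹), ?_⟩
    rw [eventually_map]
    filter_upwards [eventually_ge_atTop 2] with x hx
    simp only [hf]
    rw [norm_mul, norm_div (F _), div_eq_mul_inv ‖F _‖]
    gcongr
    · exact hGb x (by simp; linarith)
    · exact hu _ (by simp; linarith)
    · exact hl _ (by simp; linarith)
  have hz : 0 ≤ (s - 1/2 : ℂ).re := by simp; linarith
  have main := PhragmenLindelof.right_half_plane_of_bounded_on_real hd hexp hre him hz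
  simp only [hf] at main
  have e0 : (1/2 : ℂ) + (s - 1/2) = s := by ring
  have g1 := hG1 _ hz
  have g2 := hG2 _ hz
  have g3 := hF2 _ hz
  rw [e0] at main g1 g2 g3
  rw [norm_mul, norm_div, norm_div, div_mul_div_comm,
    div_le_iff₀ (mul_pos (norm_pos_iff.mpr g2) (norm_pos_iff.mpr g3))] at main
  have gu := gw_gamma_upper ((s - δ + k)/2) δ (by simp; linarith) hδ (by linarith)
  have e1 : (s - δ + k)/2 + δ = (s + δ + k)/2 := by ring
  have e2 : 2 * ‖(s - δ + k)/2 + 1‖ = ‖s - δ + k + 2‖ := by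
    have : (s - δ + k)/2 + 1 = (s - δ + k + 2)/2 := by ring
    rw [this, norm_div]; simp; ring
  rw [e1, e2] at gu
  have gp := norm_pos_iff.mpr g1
  rw [Real.mul_rpow ha.le (norm_nonneg _)]
  have : ‖Gamma ((s - δ + k)/2)‖ * ‖F (s - δ)‖ ≤
      ‖Gamma ((s - δ + k)/2)‖ * (a ^ δ * ‖s - δ + k + 2‖ ^ δ * ‖F (s + δ)‖) := by
    calc _ ≤ _ := main
      _ ≤ a ^ δ * (‖s - δ + k + 2‖ ^ δ * ‖Gamma ((s - δ + k)/2)‖ * ‖F (s + δ)‖) := by gcongr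
      _ = _ := by ring
  exact le_of_mul_le_mul_left this gp

theorem gw_logderiv_re (F : ℂ → ℂ) (hF : Differentiable ℂ F) (s : ℂ) (hs : F s ≠ 0) (σ : ℝ) :
    HasDerivAt (fun δ : ℝ => Real.log ‖F (s + σ * δ)‖) (σ * (deriv F s / F s).re) 0 := by
  have h1 : HasDerivAt (fun δ : ℝ => F (s + σ * δ)) (deriv F s * σ) 0 := by
    have hi : HasDerivAt (fun δ : ℂ => s + σ * δ) (σ : ℂ) ((0:ℝ):ℂ) := by
      simpa using ((hasDerivAt_id ((0:ℝ):ℂ)).const_mul (σ:ℂ)).const_add s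
    have ho : HasDerivAt F (deriv F s) (s + σ * ((0:ℝ):ℂ)) := by
      simpa using (hF s).hasDerivAt
    exact (HasDerivAt.comp (h := fun δ : ℂ => s + σ * δ) (h₂ := F) _ ho hi).comp_ofReal
  have h2 : HasDerivAt (fun δ : ℝ => ‖F (s + σ * δ)‖^2) (2 * inner ℝ (F s) (deriv F s * σ)) 0 := by
    have := h1.norm_sq
    simpa using this
  have h3 := h2.log (by simp [hs])
  have h4 : (fun δ : ℝ => Real.log ‖F (s + σ * δ)‖) = fun δ : ℝ => 1/2 * Real.log (‖F (s + σ * δ)‖^2) := by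
    ext δ; rw [Real.log_pow]; push_cast; ring
  rw [h4]
  refine (h3.const_mul (1/2)).congr_deriv ?_
  have hp : 0 < normSq (F s) := normSq_pos.mpr hs
  rw [ofReal_zero, mul_zero, add_zero, Complex.sq_norm, Complex.inner, div_re]
  simp
  field_simp

theorem gw_re_ge (F : ℂ → ℂ) (hF : Differentiable ℂ F) (hnz : ∀ s : ℂ, 1/2 < s.re → F s ≠ 0)
    (A c A2 : ℝ) (hc : 0 < c) (hA : ∀ s : ℂ, 1/4 ≤ s.re → ‖F s‖ ≤ A * (1 + ‖s‖))
    (hl : ∀ s : ℂ, 3/2 ≤ s.re → c ≤ ‖F s‖) (hu : ∀ s : ℂ, 3/2 ≤ s.re → ‖F s‖ ≤ A2)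
    (a k : ℝ) (ha : 0 < a) (hk : 0 ≤ k)
    (hfe : ∀ δ : ℝ, 0 < δ → δ < 1/4 → ∀ t : ℝ, ‖Gamma ((1/2 + t * I - δ + k)/2)‖ * ‖F (1/2 + t * I - δ)‖ =
      a ^ δ * (‖Gamma ((1/2 + t * I + δ + k)/2)‖ * ‖F (1/2 + t * I + δ)‖))
    (s : ℂ) (hs : 1/2 < s.re) :
    -(1/2 * Real.log (a * ‖s + k + 2‖)) ≤ (deriv F s / F s).re := by
  have hs0 := hnz s hs
  have h1 := (gw_logderiv_re F hF s hs0 1).sub (gw_logderiv_re F hF s hs0 (-1))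
  rw [hasDerivAt_iff_tendsto_slope_zero] at h1
  have h1' := h1.mono_left (nhdsWithin_mono (0:ℝ) (s := Set.Ioi 0) (t := {0}ᶜ) (by
    intro x hx; simp at hx ⊢; exact hx.ne'))
  have hne : s + k + 2 ≠ 0 := by
    intro h; have := congrArg re h; simp at this; linarith
  have h2 : Tendsto (fun δ : ℝ => -(Real.log (a * ‖s - δ + k + 2‖))) (𝓝[>] 0) (𝓝 (-(Real.log (a * ‖s + k + 2‖)))) := by
    apply tendsto_nhdsWithin_of_tendsto_nhds
    have : ContinuousAt (fun δ : ℝ => -(Real.log (a * ‖s - δ + k + 2‖))) 0 := by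
      apply ContinuousAt.neg
      apply ContinuousAt.log
      · fun_prop
      · simp [hne, ha.ne']
    have := this.tendsto
    simpa using this
  have h3 := le_of_tendsto_of_tendsto h2 h1' ?_
  · simp only [one_mul] at h3
    linarith
  · filter_upwards [Ioo_mem_nhdsGT (show (0:ℝ) < min (1/4) (s.re - 1/2) by
      apply lt_min; norm_num; linarith)] with δ hδ
    have hδ0 := hδ.1
    have hδ1 := lt_of_lt_of_le hδ.2 (min_le_left _ _)
    have hδ2 := lt_of_lt_of_le hδ.2 (min_le_right _ _)
    have P := gw_PL F hF hnz A c A2 hc hA hl hu a k ha hk δ hδ0 hδ1 (hfe δ hδ0 hδ1) s hs.le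
    have n1 : F (s - δ) ≠ 0 := hnz _ (by simp; linarith)
    have n2 : F (s + δ) ≠ 0 := hnz _ (by simp; linarith)
    have n3 : s - δ + k + 2 ≠ 0 := by
      intro h; have := congrArg re h; simp at this; linarith
    have q1 := norm_pos_iff.mpr n1
    have q2 := norm_pos_iff.mpr n2
    have q3 := norm_pos_iff.mpr n3
    have L := Real.log_le_log q1 P
    rw [Real.log_mul (by positivity) (by positivity), Real.log_rpow (by positivity)] at L
    simp only [zero_add, Pi.sub_apply, ofReal_one, one_mul, ofReal_neg, neg_mul, ofReal_zero, neg_zero, add_zero,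
      sub_self, sub_zero, smul_eq_mul, ← sub_eq_add_neg]
    rw [inv_mul_eq_div, le_div_iff₀ hδ0]
    linarith

end

section
open Complex Filter Topology MeasureTheory

noncomputable def gwH (G : ℂ → ℂ) (u : ℝ) (z : ℂ) : ℂ := G z * exp (z * u) / (1 - z^2)

theorem gw_den (z : ℂ) (h0 : 0 ≤ z.re) (h1 : z.re ≤ 3/4) : (7/32) * (1 + |z.im|)^2 ≤ ‖1 - z^2‖ := by
  have h2 : (1 - z^2).re ≤ ‖1 - z^2‖ := re_le_norm _
  have h3 : (1 - z^2).re = 1 - z.re^2 + z.im^2 := by simp [pow_two]; ring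
  have h4 : |z.im|^2 = z.im^2 := sq_abs _
  nlinarith [sq_nonneg (1 - |z.im|), abs_nonneg z.im]

theorem gw_den_ne (z : ℂ) (h0 : 0 ≤ z.re) (h1 : z.re ≤ 3/4) : (1 - z^2) ≠ 0 := by
  rw [← norm_pos_iff]
  refine lt_of_lt_of_le ?_ (gw_den z h0 h1)
  positivity

theorem gw_Hbound (G : ℂ → ℂ) (C u : ℝ) (hC : 0 ≤ C)
    (hb : ∀ z : ℂ, 0 ≤ z.re → z.re ≤ 3/4 → ‖G z‖ ≤ C * √(1 + ‖z‖)) (z : ℂ) (h0 : 0 ≤ z.re) (h1 : z.re ≤ 3/4) :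
    ‖gwH G u z‖ ≤ (2 * C * Real.exp |u| * (32/7)) * (1 + ‖z.im‖) ^ (-(3/2 : ℝ)) := by
  unfold gwH
  have hd := gw_den z h0 h1
  have hdp : 0 < (7/32) * (1 + |z.im|)^2 := by positivity
  rw [norm_div, norm_mul, norm_exp]
  have e1 : (z * u).re ≤ |u| := by
    have : (z * u).re = z.re * u := by simp
    rw [this]
    have := le_abs_self u
    nlinarith [abs_nonneg u]
  have e2 : √(1 + ‖z‖) ≤ 2 * √(1 + |z.im|) := by
    rw [show (2:ℝ) * √(1 + |z.im|) = √(4 * (1 + |z.im|)) by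
      rw [Real.sqrt_mul (by norm_num)]; congr 1; rw [show (4:ℝ) = 2^2 by norm_num, Real.sqrt_sq (by norm_num)]]
    apply Real.sqrt_le_sqrt
    have := norm_le_abs_re_add_abs_im z
    rw [abs_of_nonneg h0] at this
    linarith [abs_nonneg z.im]
  have e3 : (1 + ‖z.im‖) ^ (-(3/2 : ℝ)) = √(1 + |z.im|) / (1 + |z.im|)^2 := by
    rw [Real.norm_eq_abs, Real.sqrt_eq_rpow, ← Real.rpow_natCast, ← Real.rpow_sub (by positivity)]
    norm_num
  rw [e3]
  calc ‖G z‖ * Real.exp (z * u).re / ‖1 - z^2‖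
      ≤ (C * (2 * √(1 + |z.im|))) * Real.exp |u| / ((7/32) * (1 + |z.im|)^2) := by
        gcongr
        exact (hb z h0 h1).trans (by gcongr)
    _ = _ := by field_simp

theorem gw_integ (G : ℂ → ℂ) (C u : ℝ) (hC : 0 ≤ C)
    (hd : ∀ z : ℂ, 0 ≤ z.re → z.re ≤ 3/4 → DifferentiableAt ℂ G z)
    (hb : ∀ z : ℂ, 0 ≤ z.re → z.re ≤ 3/4 → ‖G z‖ ≤ C * √(1 + ‖z‖)) (x : ℝ) (h0 : 0 ≤ x) (h1 : x ≤ 3/4) :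
    Integrable (fun t : ℝ => gwH G u (x + t * I)) := by
  have hi : Integrable (fun t : ℝ => (2 * C * Real.exp |u| * (32/7)) * (1 + ‖t‖) ^ (-(3/2 : ℝ))) := by
    apply Integrable.const_mul
    apply integrable_one_add_norm
    norm_num
  refine hi.mono' ?_ ?_
  · apply Continuous.aestronglyMeasurable
    rw [continuous_iff_continuousAt]
    intro t
    have hc : ContinuousAt (gwH G u) (x + t * I) := by
      unfold gwH
      apply ContinuousAt.div
      · exact (hd _ (by simpa) (by simpa)).continuousAt.mul (by fun_prop)
      · fun_prop
      · exact gw_den_ne _ (by simpa) (by simpa)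
    exact ContinuousAt.comp (g := gwH G u) (f := fun t : ℝ => (x + t * I : ℂ)) hc (by fun_prop)
  · filter_upwards with t
    have := gw_Hbound G C u hC hb (x + t * I) (by simpa) (by simpa)
    simpa using this

theorem gw_contour (G : ℂ → ℂ) (C u : ℝ) (hC : 0 ≤ C)
    (hd : ∀ z : ℂ, 0 ≤ z.re → z.re ≤ 3/4 → DifferentiableAt ℂ G z)
    (hb : ∀ z : ℂ, 0 ≤ z.re → z.re ≤ 3/4 → ‖G z‖ ≤ C * √(1 + ‖z‖)) :
    ∫ t : ℝ, gwH G u (t * I) = ∫ t : ℝ, gwH G u ((3/4 : ℝ) + t * I) := by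
  have hrect : ∀ T : ℝ, (∫ x in (0:ℝ)..(3/4), gwH G u (x + (-T : ℝ) * I)) -
      (∫ x in (0:ℝ)..(3/4), gwH G u (x + (T : ℝ) * I)) +
      I • (∫ y in (-T)..T, gwH G u ((3/4 : ℝ) + y * I)) - I • (∫ y in (-T)..T, gwH G u ((0:ℝ) + y * I)) = 0 := by
    intro T
    have := integral_boundary_rect_eq_zero_of_differentiableOn (gwH G u) (⟨0, -T⟩) (⟨3/4, T⟩) ?_
    · simpa using this
    · intro z hz
      rw [mem_reProdIm] at hz
      have hzr := hz.1
      simp only [] at hzr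
      rw [Set.uIcc_of_le (by norm_num)] at hzr
      apply DifferentiableAt.differentiableWithinAt
      unfold gwH
      apply DifferentiableAt.div
      · exact (hd _ hzr.1 hzr.2).mul (by fun_prop)
      · fun_prop
      · exact gw_den_ne _ hzr.1 hzr.2
  have hv1 : Tendsto (fun T : ℝ => ∫ y in (-T)..T, gwH G u ((3/4 : ℝ) + y * I)) atTop
      (𝓝 (∫ t : ℝ, gwH G u ((3/4 : ℝ) + t * I))) :=
    intervalIntegral_tendsto_integral (gw_integ G C u hC hd hb (3/4) (by norm_num) (by norm_num))
      tendsto_neg_atTop_atBot tendsto_id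
  have hv0 : Tendsto (fun T : ℝ => ∫ y in (-T)..T, gwH G u ((0 : ℝ) + y * I)) atTop
      (𝓝 (∫ t : ℝ, gwH G u ((0 : ℝ) + t * I))) :=
    intervalIntegral_tendsto_integral (gw_integ G C u hC hd hb 0 (by norm_num) (by norm_num))
      tendsto_neg_atTop_atBot tendsto_id
  have hdec : Tendsto (fun T : ℝ => (2 * C * Real.exp |u| * (32/7)) * (1 + ‖T‖) ^ (-(3/2 : ℝ)) * |3/4 - 0|) atTop (𝓝 0) := by
    have h1 : Tendsto (fun T : ℝ => 1 + ‖T‖) atTop atTop :=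
      tendsto_atTop_add_const_left _ _ tendsto_norm_atTop_atTop
    have h2 := (tendsto_rpow_neg_atTop (show (0:ℝ) < 3/2 by norm_num)).comp h1
    have h3 := (h2.const_mul (2 * C * Real.exp |u| * (32/7))).mul_const |(3/4 - 0 : ℝ)|
    simpa using h3
  have hh : ∀ σ : ℝ, |σ| = 1 → Tendsto (fun T : ℝ => ∫ x in (0:ℝ)..(3/4), gwH G u (x + (σ * T : ℝ) * I)) atTop (𝓝 0) := by
    intro σ hσ
    refine squeeze_zero_norm ?_ hdec
    intro T
    apply intervalIntegral.norm_integral_le_of_norm_le_const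
    intro x hx
    rw [Set.uIoc_of_le (by norm_num)] at hx
    have := gw_Hbound G C u hC hb (x + (σ * T : ℝ) * I) (by simpa using hx.1.le) (by simpa using hx.2)
    refine this.trans (le_of_eq ?_)
    have e : (x + (σ * T : ℝ) * I : ℂ).im = σ * T := by simp
    rw [e, norm_mul, Real.norm_eq_abs σ, hσ, one_mul]
  have hm := hh (-1) (by simp)
  have hp := hh 1 (by simp)
  simp only [neg_mul, one_mul] at hm hp
  have hlim := ((hm.sub hp).add (hv1.const_smul I)).sub (hv0.const_smul I)
  have hz : (fun T : ℝ => (∫ x in (0:ℝ)..(3/4), gwH G u (x + (-T : ℝ) * I)) -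
      (∫ x in (0:ℝ)..(3/4), gwH G u (x + (T : ℝ) * I)) +
      I • (∫ y in (-T)..T, gwH G u ((3/4 : ℝ) + y * I)) - I • (∫ y in (-T)..T, gwH G u ((0:ℝ) + y * I))) = fun _ => 0 := by
    ext T; exact hrect T
  rw [hz] at hlim
  have := tendsto_nhds_unique hlim tendsto_const_nhds
  rw [sub_self, zero_add, ← smul_sub, smul_eq_zero] at this
  rcases this with h | h
  · exact absurd h I_ne_zero
  · rw [sub_eq_zero] at h
    rw [h]; simp

theorem gw_split (f : ℝ → ℂ) (a b : ℂ) (ha : a.re < 0) (hb : 0 < b.re)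
    (h1 : ∀ x ∈ Set.Ioi (0:ℝ), f x = exp (a * x)) (h2 : ∀ x ∈ Set.Iic (0:ℝ), f x = exp (b * x)) :
    Integrable f ∧ ∫ x, f x = -1/a + 1/b := by
  have i1 : IntegrableOn f (Set.Ioi 0) :=
    (integrableOn_exp_mul_complex_Ioi ha 0).congr_fun (fun x hx => (h1 x hx).symm) measurableSet_Ioi
  have i2 : IntegrableOn f (Set.Iic 0) :=
    (integrableOn_exp_mul_complex_Iic hb 0).congr_fun (fun x hx => (h2 x hx).symm) measurableSet_Iic
  constructor
  · rw [← integrableOn_univ, ← Set.Iic_union_Ioi (a := (0:ℝ))]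
    exact i2.union i1
  · rw [← intervalIntegral.integral_Iic_add_Ioi i2 i1, setIntegral_congr_fun measurableSet_Ioi h1,
      setIntegral_congr_fun measurableSet_Iic h2, integral_exp_mul_complex_Ioi ha,
      integral_exp_mul_complex_Iic hb]
    simp
    ring

open FourierTransform in
theorem gw_fourier (v : ℝ) : ∫ t : ℝ, exp (t * I * v) / (1 - (t * I)^2) = ((Real.pi * Real.exp (-|v|) : ℝ) : ℂ) := by
  set f : ℝ → ℂ := fun v => exp (-(|v| : ℝ)) with hf
  have hcont : Continuous f := by fun_prop
  have hIntg : Integrable f := by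
    refine (gw_split f (-1) 1 (by simp) (by simp) ?_ ?_).1
    · intro x hx
      have hx : 0 < x := hx
      simp [hf, abs_of_pos hx]
    · intro x hx
      have hx : x ≤ 0 := hx
      simp [hf, abs_of_nonpos hx]
  have hft : ∀ w : ℝ, 𝓕 f w = 2 / (1 - ((2 * Real.pi * w : ℝ) * I)^2) := by
    intro w
    rw [Real.fourier_real_eq_integral_exp_smul]
    have := (gw_split (fun v : ℝ => exp (((-2 * Real.pi * v * w : ℝ) : ℂ) * I) • f v)
      (-1 - (2 * Real.pi * w : ℝ) * I) (1 - (2 * Real.pi * w : ℝ) * I) (by simp) (by simp) ?_ ?_).2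
    · rw [this]
      have n1 : (-1 - (2 * Real.pi * w : ℝ) * I) ≠ 0 := by
        intro h; have := congrArg re h; simp at this
      have n2 : (1 - (2 * Real.pi * w : ℝ) * I) ≠ 0 := by
        intro h; have := congrArg re h; simp at this
      have e : (1 - ((2 * Real.pi * w : ℝ) * I)^2) = -((-1 - (2 * Real.pi * w : ℝ) * I) * (1 - (2 * Real.pi * w : ℝ) * I)) := by ring
      rw [e]
      field_simp
      ring
    · intro x hx
      have hx : 0 < x := hx
      simp only [hf, abs_of_pos hx, smul_eq_mul]
      rw [← exp_add]; congr 1; push_cast; ring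
    · intro x hx
      have hx : x ≤ 0 := hx
      simp only [hf, abs_of_nonpos hx, smul_eq_mul]
      rw [← exp_add]; congr 1; push_cast; ring
  have hb1 : Integrable (fun t : ℝ => gwH (fun _ => 1) 0 ((0:ℝ) + t * I)) := by
    refine gw_integ (fun _ => 1) 1 0 (by norm_num) (fun z _ _ => by fun_prop) ?_ 0 le_rfl (by norm_num)
    intro z _ _
    simp
  have hIntg2 : Integrable (𝓕 f) := by
    have h2 : 𝓕 f = fun w => 2 * gwH (fun _ => 1) 0 ((0:ℝ) + ((2 * Real.pi * w : ℝ)) * I) := by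
      ext w; rw [hft]; simp [gwH]; ring
    rw [h2]
    exact (hb1.comp_mul_left' (R := 2 * Real.pi) (by positivity)).const_mul 2
  have inv := hcont.fourierInv_fourier_eq hIntg hIntg2
  have inv2 := congrFun inv v
  rw [Real.fourierInv_eq'] at inv2
  simp_rw [hft] at inv2
  have hs := Measure.integral_comp_mul_left (fun t : ℝ => exp (t * I * v) / (1 - (t * I)^2)) (2 * Real.pi)
  have e : (∫ w : ℝ, exp (((2 * Real.pi * inner ℝ w v : ℝ) : ℂ) * I) • (2 / (1 - ((2 * Real.pi * w : ℝ) * I)^2) : ℂ)) =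
      2 * ∫ w : ℝ, exp (((2 * Real.pi * w : ℝ) : ℂ) * I * v) / (1 - ((2 * Real.pi * w : ℝ) * I)^2) := by
    rw [← integral_const_mul]
    congr 1
    ext w
    rw [smul_eq_mul, show (inner ℝ w v : ℝ) = v * w by simp]
    have : ((2 * Real.pi * (v * w) : ℝ) : ℂ) * I = ((2 * Real.pi * w : ℝ) : ℂ) * I * v := by push_cast; ring
    rw [this]; ring
  rw [e, hs] at inv2
  simp only [hf] at inv2
  rw [abs_of_pos (by positivity), Complex.real_smul] at inv2
  have hpi : (Real.pi : ℂ) ≠ 0 := by exact_mod_cast Real.pi_ne_zero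
  push_cast at inv2 ⊢
  rw [← inv2]
  generalize (∫ y : ℝ, exp (y * I * v) / (1 - (y * I)^2)) = J
  field_simp

theorem gw_series (G : ℂ → ℂ) (C : ℝ) (hC : 0 ≤ C)
    (hd : ∀ z : ℂ, 0 ≤ z.re → z.re ≤ 3/4 → DifferentiableAt ℂ G z)
    (hb : ∀ z : ℂ, 0 ≤ z.re → z.re ≤ 3/4 → ‖G z‖ ≤ C * √(1 + ‖z‖))
    (c : ℕ → ℂ) (l : ℕ → ℝ) (hsum : Summable fun n => ‖c n‖ * Real.exp (-(3/4) * l n))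
    (hG : ∀ t : ℝ, G ((3/4 : ℝ) + t * I) = ∑' n, c n * exp (-((3/4 : ℝ) + t * I) * l n)) (u : ℝ) :
    ∫ t : ℝ, gwH G u (t * I) = Real.pi * ∑' n, c n * ((Real.exp (-|u - l n|) : ℝ) : ℂ) := by
  rw [gw_contour G C u hC hd hb]
  have hone : ∀ z : ℂ, 0 ≤ z.re → z.re ≤ 3/4 → ‖(fun _ : ℂ => (1:ℂ)) z‖ ≤ 1 * √(1 + ‖z‖) := by
    intro z _ _; simp
  have hterm : ∀ n, ∫ t : ℝ, c n * gwH (fun _ => 1) (u - l n) ((3/4 : ℝ) + t * I) =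
      Real.pi * (c n * ((Real.exp (-|u - l n|) : ℝ) : ℂ)) := by
    intro n
    rw [integral_const_mul, ← gw_contour (fun _ => 1) 1 (u - l n) (by norm_num) (fun z _ _ => by fun_prop) hone]
    have := gw_fourier (u - l n)
    simp only [gwH, one_mul]
    rw [this]; push_cast; ring
  rw [← tsum_mul_left]
  simp_rw [← hterm]
  have hnorm : ∀ n, ∀ t : ℝ, ‖c n * gwH (fun _ => 1) (u - l n) ((3/4 : ℝ) + t * I)‖ =
      (‖c n‖ * Real.exp (-(3/4) * l n)) * (‖gwH (fun _ => 1) u ((3/4 : ℝ) + t * I)‖) := by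
    intro n t
    unfold gwH
    rw [norm_mul, norm_div, norm_div, norm_mul, norm_mul, norm_exp, norm_exp]
    have e : ((((3/4 : ℝ) : ℂ) + t * I) * ((u - l n : ℝ) : ℂ)).re = -(3/4) * l n + ((((3/4 : ℝ) : ℂ) + t * I) * (u : ℂ)).re := by
      simp; ring
    rw [e, Real.exp_add]; ring
  rw [integral_tsum_of_summable_integral_norm]
  · congr 1
    ext t
    rw [gwH, hG, ← tsum_mul_right, ← tsum_div_const]
    congr 1
    ext n
    unfold gwH
    rw [mul_assoc, ← exp_add, one_mul, mul_div_assoc]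
    congr 3; push_cast; ring
  · intro n
    exact (gw_integ (fun _ => 1) 1 (u - l n) (by norm_num) (fun z _ _ => by fun_prop) hone (3/4) (by norm_num) le_rfl).const_mul _
  · simp_rw [hnorm, integral_const_mul]
    exact hsum.mul_right _

end

section
open Complex Filter Topology MeasureTheory

theorem gw_char_partial (p : ℕ) [Fact p.Prime] (χ : DirichletCharacter ℂ p) (hχ : χ ≠ 1) (n : ℕ) :
    ‖∑ k ∈ Finset.Icc 1 n, χ (k : ZMod p)‖ ≤ p := by
  have hp : p.Prime := Fact.out
  have : NeZero p := ⟨hp.ne_zero⟩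
  have h0 : ∑ i ∈ Finset.range p, χ (i : ZMod p) = 0 := by
    have := MulChar.sum_eq_zero_of_ne_one hχ
    rw [← this]
    refine Finset.sum_bij (fun i _ => (i : ZMod p)) (by simp) ?_ ?_ (by simp)
    · intro a ha b hb h
      rw [ZMod.natCast_eq_natCast_iff'] at h
      rwa [Nat.mod_eq_of_lt (Finset.mem_range.mp ha), Nat.mod_eq_of_lt (Finset.mem_range.mp hb)] at h
    · intro b _
      exact ⟨b.val, Finset.mem_range.mpr (ZMod.val_lt b), by simp⟩
  have h1 : ∀ m : ℕ, ∑ i ∈ Finset.range (p * m), χ (i : ZMod p) = 0 := by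
    intro m
    induction m with
    | zero => simp
    | succ m ih =>
      rw [mul_add, mul_one, Finset.sum_range_add, ih, zero_add, ← h0]
      apply Finset.sum_congr rfl
      intro i _
      simp
  have h2 : ∑ k ∈ Finset.Icc 1 n, χ (k : ZMod p) = ∑ k ∈ Finset.range (n+1), χ (k : ZMod p) := by
    rw [Finset.range_eq_Ico, Finset.sum_eq_sum_Ico_succ_bot (by omega)]
    have : χ ((0:ℕ) : ZMod p) = 0 := by
      rw [Nat.cast_zero]; exact MulChar.map_zero χ
    rw [this, zero_add]; rfl
  rw [h2, ← Nat.div_add_mod (n+1) p, Finset.sum_range_add, h1, zero_add]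
  refine (norm_sum_le _ _).trans ?_
  refine (Finset.sum_le_card_nsmul _ _ 1 ?_).trans ?_
  · intro x _; exact χ.norm_le_one _
  · simp only [Finset.card_range, nsmul_eq_mul, mul_one]
    exact_mod_cast (Nat.mod_lt _ hp.pos).le

theorem gw_L_bound (p : ℕ) [Fact p.Prime] [NeZero p] (χ : DirichletCharacter ℂ p) (hχ : χ ≠ 1) :
    ∃ A : ℝ, ∀ s : ℂ, 1/4 ≤ s.re → ‖DirichletCharacter.LFunction χ s‖ ≤ A * (1 + ‖s‖) := by
  set S : ℝ → ℂ := fun t => ∑ k ∈ Finset.Icc 1 ⌊t⌋₊, χ (k : ZMod p) with hS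
  have hSb : ∀ t, ‖S t‖ ≤ p := fun t => gw_char_partial p χ hχ _
  have hS0 : ∀ t, t < 1 → S t = 0 := by
    intro t ht
    have : ⌊t⌋₊ = 0 := Nat.floor_eq_zero.mpr ht
    simp [hS, this]
  have hSm : Measurable S := by
    have : Measurable (fun n : ℕ => ∑ k ∈ Finset.Icc 1 n, χ (k : ZMod p)) := measurable_from_top
    exact this.comp Nat.measurable_floor
  have hloc : LocallyIntegrableOn S (Set.Ioi 0) := by
    have : LocallyIntegrable S := by
      have h : LocallyIntegrable (fun _ : ℝ => (p : ℝ)) := continuous_const.locallyIntegrable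
      refine h.mono hSm.aestronglyMeasurable (ae_of_all _ fun t => ?_)
      simpa using hSb t
    exact this.locallyIntegrableOn _
  have hdiff : ∀ s : ℂ, 0 < s.re → DifferentiableAt ℂ (fun s => s * mellin S (-s)) s := by
    intro s hs
    refine differentiableAt_id.mul ?_
    have h : DifferentiableAt ℂ (mellin S) (-s) := by
      refine mellin_differentiableAt_of_isBigO_rpow (a := 0) (b := (-s).re - 1) hloc ?_ (by simpa using hs) ?_ (by linarith)
      · refine Asymptotics.IsBigO.of_bound p (Eventually.of_forall fun t => ?_)
        simpa using hSb t
      · refine Asymptotics.IsBigO.of_bound 0 ?_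
        have : ∀ᶠ t : ℝ in 𝓝[>] 0, t < 1 := eventually_nhdsWithin_of_eventually_nhds (eventually_lt_nhds one_pos)
        filter_upwards [this] with t ht
        simp [hS0 t ht]
    exact h.comp s differentiableAt_id.neg
  have hmel : ∀ s : ℂ, mellin S (-s) = ∫ t in Set.Ioi (1:ℝ), S t * (t : ℂ) ^ (-(s+1)) := by
    intro s
    unfold mellin
    have h1 := setIntegral_eq_of_subset_of_forall_sdiff_eq_zero (μ := volume) (s := Set.Ici (1:ℝ)) (t := Set.Ioi (0:ℝ))
      (f := fun t : ℝ => (t : ℂ) ^ (-s - 1) • S t) measurableSet_Ioi (Set.Ici_subset_Ioi.mpr one_pos) ?_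
    · rw [h1, integral_Ici_eq_integral_Ioi]
      congr 1
      ext t
      rw [smul_eq_mul, mul_comm, neg_add, sub_eq_add_neg]
    · intro t ht
      have : t < 1 := by simpa using ht.2
      simp [hS0 t this]
  have heq1 : ∀ s : ℂ, 1 < s.re → DirichletCharacter.LFunction χ s = s * mellin S (-s) := by
    intro s hs
    rw [DirichletCharacter.LFunction_eq_LSeries χ hs, hmel]
    refine LSeries_eq_mul_integral _ le_rfl (by linarith) (DirichletCharacter.LSeriesSummable_of_one_lt_re χ hs) ?_
    refine Asymptotics.IsBigO.of_bound p (Eventually.of_forall fun t => ?_)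
    simpa using gw_char_partial p χ hχ t
  have heq : ∀ s : ℂ, 0 < s.re → DirichletCharacter.LFunction χ s = s * mellin S (-s) := by
    have hopen : IsOpen {s : ℂ | 0 < s.re} := isOpen_lt continuous_const continuous_re
    have a1 : AnalyticOnNhd ℂ (DirichletCharacter.LFunction χ) {s : ℂ | 0 < s.re} :=
      ((DirichletCharacter.differentiable_LFunction hχ).differentiableOn).analyticOnNhd hopen
    have a2 : AnalyticOnNhd ℂ (fun s => s * mellin S (-s)) {s : ℂ | 0 < s.re} :=
      (DifferentiableOn.analyticOnNhd (fun s hs => (hdiff s hs).differentiableWithinAt) hopen)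
    have := a1.eqOn_of_preconnected_of_eventuallyEq a2 (convex_halfSpace_re_gt 0).isPreconnected (z₀ := 2) (by simp) ?_
    · exact fun s hs => this hs
    · have : ∀ᶠ s : ℂ in 𝓝 2, 1 < s.re :=
        (isOpen_lt continuous_const continuous_re).mem_nhds (by simp)
      filter_upwards [this] with s hs using heq1 s hs
  refine ⟨4 * p, fun s hs => ?_⟩
  rw [heq s (by linarith), norm_mul, hmel]
  have hb : ‖∫ t in Set.Ioi (1:ℝ), S t * (t : ℂ) ^ (-(s+1))‖ ≤ 4 * p := by
    have hi : IntegrableOn (fun t : ℝ => (p:ℝ) * t ^ (-(5/4) : ℝ)) (Set.Ioi 1) :=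
      (integrableOn_Ioi_rpow_of_lt (by norm_num) one_pos).const_mul _
    refine (norm_integral_le_of_norm_le hi ?_).trans ?_
    · filter_upwards [ae_restrict_mem measurableSet_Ioi] with t ht
      have ht : 1 < t := ht
      rw [norm_mul, norm_cpow_eq_rpow_re_of_pos (by linarith)]
      refine mul_le_mul (hSb t) ?_ (by positivity) (by positivity)
      apply Real.rpow_le_rpow_of_exponent_le ht.le
      simp; linarith
    · rw [integral_const_mul, integral_Ioi_rpow_of_lt (by norm_num) one_pos]
      norm_num
      linarith
  have : (0:ℝ) ≤ p := by positivity
  nlinarith [norm_nonneg s]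

theorem gw_L_upper_lower (p : ℕ) [NeZero p] (χ : DirichletCharacter ℂ p) :
    ∃ A c : ℝ, 0 < c ∧ (∀ s : ℂ, 3/2 ≤ s.re → ‖DirichletCharacter.LFunction χ s‖ ≤ A) ∧
      (∀ s : ℂ, 3/2 ≤ s.re → c ≤ ‖DirichletCharacter.LFunction χ s‖) := by
  have key : ∀ f : ℕ → ℂ, (∀ n, ‖f n‖ ≤ 1) → ∀ s : ℂ, 3/2 ≤ s.re → ‖LSeries f s‖ ≤ ∑' n : ℕ, 1 / (n:ℝ)^(3/2:ℝ) := by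
    intro f hf s hs
    refine tsum_of_norm_bounded (Real.summable_one_div_nat_rpow.mpr (by norm_num)).hasSum ?_
    intro n
    rw [LSeries.norm_term_eq]
    split_ifs with h
    · positivity
    · have : (1:ℝ) ≤ n := by exact_mod_cast Nat.one_le_iff_ne_zero.mpr h
      gcongr
      · exact hf n
  set Z := ∑' n : ℕ, 1 / (n:ℝ)^(3/2:ℝ) with hZ
  have hZ0 : 0 ≤ Z := tsum_nonneg fun n => by positivity
  refine ⟨Z, (Z+1)⁻¹, by positivity, ?_, ?_⟩
  · intro s hs
    rw [DirichletCharacter.LFunction_eq_LSeries χ (by linarith)]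
    exact key _ (fun n => χ.norm_le_one _) s hs
  · intro s hs
    rw [DirichletCharacter.LFunction_eq_LSeries χ (by linarith)]
    have h := DirichletCharacter.LSeries.mul_mu_eq_one χ (s := s) (by linarith)
    have h2 := congrArg norm h
    rw [norm_mul, norm_one] at h2
    have h3 := key ((fun n : ℕ => χ n) * fun n : ℕ => ((ArithmeticFunction.moebius n : ℤ) : ℂ)) ?_ s hs
    · rw [inv_le_iff_one_le_mul₀ (by positivity), ← h2]
      gcongr
      linarith
    · intro n
      simp only [Pi.mul_apply, norm_mul]
      refine mul_le_one₀ (χ.norm_le_one _) (norm_nonneg _) ?_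
      rw [norm_intCast]
      exact_mod_cast ArithmeticFunction.abs_moebius_le_one

theorem gw_L_conj (p : ℕ) [Fact p.Prime] [NeZero p] (χ : DirichletCharacter ℂ p) (hχ : χ ≠ 1) (s : ℂ) :
    DirichletCharacter.LFunction χ⁻¹ s = (starRingEnd ℂ) (DirichletCharacter.LFunction χ ((starRingEnd ℂ) s)) := by
  have a1 : AnalyticOnNhd ℂ (DirichletCharacter.LFunction χ⁻¹) Set.univ :=
      ((DirichletCharacter.differentiable_LFunction (inv_ne_one.mpr hχ)).differentiableOn).analyticOnNhd isOpen_univ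
  have a2 : AnalyticOnNhd ℂ ((starRingEnd ℂ) ∘ (DirichletCharacter.LFunction χ) ∘ (starRingEnd ℂ)) Set.univ := by
    apply DifferentiableOn.analyticOnNhd _ isOpen_univ
    intro z _
    have := (DirichletCharacter.differentiable_LFunction hχ ((starRingEnd ℂ) z)).conj_conj
    simp only [Complex.conj_conj] at this
    exact this.differentiableWithinAt
  have := a1.eqOn_of_preconnected_of_eventuallyEq a2 isPreconnected_univ (z₀ := 2) (by simp) ?_
  · exact this (Set.mem_univ s)
  · have : ∀ᶠ s : ℂ in 𝓝 2, 1 < s.re :=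
      (isOpen_lt continuous_const continuous_re).mem_nhds (by simp)
    filter_upwards [this] with s hs
    simp only [Function.comp]
    rw [DirichletCharacter.LFunction_eq_LSeries _ hs, DirichletCharacter.LFunction_eq_LSeries _ (by simpa using hs)]
    unfold LSeries
    rw [Complex.conj_tsum]
    congr 1
    ext n
    rcases Nat.eq_zero_or_pos n with rfl | hn
    · simp
    · rw [LSeries.term_of_ne_zero hn.ne', LSeries.term_of_ne_zero hn.ne', map_div₀]
      congr 1
      · rw [← MulChar.star_eq_inv]; rfl
      · rw [Complex.cpow_conj]
        · simp
        · rw [natCast_arg]; exact Real.pi_pos.ne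

theorem gw_root (p : ℕ) [Fact p.Prime] [NeZero p] (χ : DirichletCharacter ℂ p) (hχ : χ ≠ 1) :
    ‖DirichletCharacter.rootNumber χ‖ = 1 := by
  have hp : p.Prime := Fact.out
  have h := gaussSum_mul_gaussSum_eq_card hχ (ZMod.isPrimitive_stdAddChar p)
  have h2 : gaussSum χ⁻¹ (ZMod.stdAddChar (N := p))⁻¹ = (starRingEnd ℂ) (gaussSum χ (ZMod.stdAddChar (N := p))) := by
    unfold gaussSum
    rw [map_sum]
    congr 1; ext a
    rw [map_mul, ← MulChar.star_eq_inv, AddChar.inv_apply, AddChar.map_neg_eq_conj]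
    rfl
  rw [h2, Complex.mul_conj, ZMod.card] at h
  have h3 : Complex.normSq (gaussSum χ (ZMod.stdAddChar (N := p))) = p := by exact_mod_cast h
  rw [Complex.normSq_eq_norm_sq] at h3
  have h4 : ‖gaussSum χ (ZMod.stdAddChar (N := p))‖ = √p := by
    rw [← h3, Real.sqrt_sq (norm_nonneg _)]
  have hpp : (0:ℝ) < p := by exact_mod_cast hp.pos
  unfold DirichletCharacter.rootNumber
  rw [norm_div, norm_div, h4, norm_pow, norm_I, one_pow, div_one]
  have : ‖(p:ℂ) ^ (1/2 : ℂ)‖ = √p := by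
    rw [norm_natCast_cpow_of_pos hp.pos, Real.sqrt_eq_rpow]; norm_num
  rw [this, div_self]; positivity

theorem gw_prim (p : ℕ) [Fact p.Prime] [NeZero p] (χ : DirichletCharacter ℂ p) (hχ : χ ≠ 1) : χ.IsPrimitive := by
  have hp : p.Prime := Fact.out
  rcases (Nat.dvd_prime hp).mp (DirichletCharacter.conductor_dvd_level χ) with h | h
  · exact absurd (DirichletCharacter.eq_one_iff_conductor_eq_one.mpr h) hχ
  · exact h

theorem gw_hfe (p : ℕ) [Fact p.Prime] [NeZero p] (χ : DirichletCharacter ℂ p) (hχ : χ ≠ 1) :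
    ∃ k : ℝ, 0 ≤ k ∧ k ≤ 1 ∧ ∀ δ : ℝ, 0 < δ → δ < 1/4 → ∀ t : ℝ,
      ‖Gamma ((1/2 + t*I - δ + k)/2)‖ * ‖DirichletCharacter.LFunction χ (1/2 + t*I - δ)‖ =
      (p / Real.pi)^δ * (‖Gamma ((1/2 + t*I + δ + k)/2)‖ * ‖DirichletCharacter.LFunction χ (1/2 + t*I + δ)‖) := by
  have hp : p.Prime := Fact.out
  have hpp : (0:ℝ) < p := by exact_mod_cast hp.pos
  have hpi := Real.pi_pos
  have hgf : ∃ k : ℝ, 0 ≤ k ∧ k ≤ 1 ∧ ∀ s, DirichletCharacter.gammaFactor χ s = Gammaℝ (s + k) ∧ DirichletCharacter.gammaFactor χ⁻¹ s = Gammaℝ (s + k) := by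
    rcases χ.even_or_odd with h | h
    · refine ⟨0, le_rfl, zero_le_one, fun s => ?_⟩
      have h' : (χ⁻¹).Even := by
        unfold DirichletCharacter.Even at *
        rw [MulChar.inv_apply]; simpa using h
      rw [h.gammaFactor_def, h'.gammaFactor_def]; simp
    · refine ⟨1, zero_le_one, le_rfl, fun s => ?_⟩
      have h' : (χ⁻¹).Odd := by
        unfold DirichletCharacter.Odd at *
        rw [MulChar.inv_apply]; simpa using h
      rw [h.gammaFactor_def, h'.gammaFactor_def]; simp
  obtain ⟨k, hk0, hk1, hk⟩ := hgf
  refine ⟨k, hk0, hk1, fun δ hδ hδ' t => ?_⟩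
  have hLf : ∀ (χ' : DirichletCharacter ℂ p) (s : ℂ), DirichletCharacter.gammaFactor χ' s = Gammaℝ (s + k) → 0 < s.re →
      DirichletCharacter.completedLFunction χ' s = Gammaℝ (s + k) * DirichletCharacter.LFunction χ' s := by
    intro χ' s h hs
    rw [DirichletCharacter.LFunction_eq_completed_div_gammaFactor χ' s (Or.inr hp.one_lt.ne'), h]
    have : Gammaℝ (s + k) ≠ 0 := Gammaℝ_ne_zero_of_re_pos (by simp; linarith)
    field_simp
  set s : ℂ := 1/2 + t*I - δ with hs
  set s' : ℂ := 1/2 + t*I + δ with hs'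
  have e1 : 1 - (starRingEnd ℂ) s' = s := by
    rw [hs, hs']
    apply Complex.ext <;> simp
    ring
  have hr : s.re = 1/2 - δ := by simp [hs]
  have hr' : s'.re = 1/2 + δ := by simp [hs']
  have hrc : ((starRingEnd ℂ) s').re = 1/2 + δ := by rw [conj_re, hr']
  have fe := (gw_prim p χ hχ).completedLFunction_one_sub ((starRingEnd ℂ) s')
  rw [e1, hLf χ s (hk s).1 (by linarith), hLf χ⁻¹ _ (hk _).2 (by linarith), gw_L_conj p χ hχ, Complex.conj_conj] at fe
  have fe2 := congrArg norm fe
  rw [norm_mul, norm_mul, norm_mul, norm_mul, gw_root p χ hχ, mul_one, Complex.norm_conj] at fe2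
  have ec : (starRingEnd ℂ) s' + k = (starRingEnd ℂ) (s' + k) := by simp
  rw [ec] at fe2
  simp only [Gammaℝ_def, norm_mul] at fe2
  have ed : (starRingEnd ℂ) (s' + k) / 2 = (starRingEnd ℂ) ((s' + k)/2) := by rw [map_div₀, Complex.conj_ofNat]
  rw [ed, Complex.Gamma_conj, Complex.norm_conj, norm_natCast_cpow_of_pos hp.pos,
    norm_cpow_eq_rpow_re_of_pos hpi, norm_cpow_eq_rpow_re_of_pos hpi] at fe2
  have q1 : (-(s + (k:ℂ)) / 2).re = -(1/2+k)/2 + δ/2 := by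
    rw [show (-(s + (k:ℂ)) / 2) = (-(s+k)) / ((2:ℝ):ℂ) by simp, div_ofReal_re]
    simp [hr]; ring
  have q2 : (-((starRingEnd ℂ) (s' + (k:ℂ))) / 2).re = -(1/2+k)/2 + -(δ/2) := by
    rw [show (-((starRingEnd ℂ) (s' + (k:ℂ))) / 2) = (-((starRingEnd ℂ) (s' + (k:ℂ)))) / ((2:ℝ):ℂ) by simp, div_ofReal_re]
    simp [hr']; ring
  have q3 : ((starRingEnd ℂ) s' - 1/2).re = δ := by
    rw [sub_re, hrc]; simp
  rw [q1, q2, q3, Real.rpow_add hpi, Real.rpow_add hpi, Real.rpow_neg hpi.le (δ/2)] at fe2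
  rw [Real.div_rpow hpp.le hpi.le]
  have q4 : Real.pi ^ δ = Real.pi^(δ/2) * Real.pi^(δ/2) := by
    rw [← Real.rpow_add hpi]; ring_nf
  rw [q4]
  have n1 : (0:ℝ) < Real.pi^(δ/2) := by positivity
  have n2 : (0:ℝ) < Real.pi^(-(1/2+k)/2) := by positivity
  generalize ‖Gamma ((s + k)/2)‖ = X1 at *
  generalize ‖DirichletCharacter.LFunction χ s‖ = X2 at *
  generalize ‖Gamma ((s' + k)/2)‖ = X3 at *
  generalize ‖DirichletCharacter.LFunction χ s'‖ = X4 at *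
  generalize Real.pi^(δ/2) = X5 at *
  generalize Real.pi^(-(1/2+k)/2) = X6 at *
  generalize (p:ℝ)^δ = X7 at *
  field_simp at fe2 ⊢
  linarith

end

section
open Complex Filter Topology MeasureTheory

theorem gw_pos (D : ℝ → ℂ) (L : ℝ → ℝ) (α : ℝ) (hα : 0 ≤ α)
    (hD : Integrable (fun t : ℝ => D t * (((1 + t^2)⁻¹ : ℝ) : ℂ)))
    (hLi : Integrable (fun t : ℝ => L t * (1 + t^2)⁻¹)) (hL0 : ∀ t, 0 ≤ L t)
    (hM : ∀ t, 2 * (D t).re ≤ α + L t) (u : ℝ) :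
    ‖∫ t : ℝ, D t * exp (t * I * u) * (((1 + t^2)⁻¹ : ℝ) : ℂ)‖ ≤
      ‖∫ t : ℝ, D t * exp (t * I * (-u : ℝ)) * (((1 + t^2)⁻¹ : ℝ) : ℂ)‖ + α * (Real.pi * (1 + Real.exp (-|u|)))
       + 2 * (∫ t : ℝ, L t * (1 + t^2)⁻¹) + 2 * ‖∫ t : ℝ, D t * exp (t * I * (0 : ℝ)) * (((1 + t^2)⁻¹ : ℝ) : ℂ)‖ := by
  have hexp : ∀ (t v : ℝ), ‖exp (t * I * v)‖ = 1 := by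
    intro t v
    rw [norm_exp]; simp
  have hPi : Integrable (fun t : ℝ => (1 + t^2)⁻¹) := integrable_inv_one_add_sq
  have hce : ∀ v : ℝ, Continuous (fun t : ℝ => exp (t * I * v)) := fun v => by fun_prop
  -- multiplying an integrable function by the exponential
  have hmul : ∀ (g : ℝ → ℂ) (v : ℝ), Integrable g → Integrable (fun t : ℝ => exp (t * I * v) * g t) := by
    intro g v hg
    refine hg.bdd_mul (c := 1) (hce v).aestronglyMeasurable (ae_of_all _ fun t => (hexp t v).le)
  have hDc : Integrable (fun t : ℝ => (starRingEnd ℂ) (D t) * (((1 + t^2)⁻¹ : ℝ) : ℂ)) := by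
    have := (Complex.conjCLE : ℂ →L[ℝ] ℂ).integrable_comp hD
    refine this.congr (ae_of_all _ fun t => ?_)
    simp
  have e1 : (starRingEnd ℂ) (∫ t : ℝ, D t * exp (t * I * (-u : ℝ)) * (((1 + t^2)⁻¹ : ℝ) : ℂ)) =
      ∫ t : ℝ, exp (t * I * u) * ((starRingEnd ℂ) (D t) * (((1 + t^2)⁻¹ : ℝ) : ℂ)) := by
    rw [← integral_conj]
    congr 1
    ext t
    rw [map_mul, map_mul, ← exp_conj, conj_ofReal]
    have : (starRingEnd ℂ) (t * I * (-u : ℝ)) = t * I * u := by simp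
    rw [this]; ring
  have e2 : (∫ t : ℝ, D t * exp (t * I * u) * (((1 + t^2)⁻¹ : ℝ) : ℂ)) =
      ∫ t : ℝ, exp (t * I * u) * (D t * (((1 + t^2)⁻¹ : ℝ) : ℂ)) := by
    congr 1; ext t; ring
  have e0 : (∫ t : ℝ, D t * exp (t * I * (0:ℝ)) * (((1 + t^2)⁻¹ : ℝ) : ℂ)) =
      ∫ t : ℝ, (D t * (((1 + t^2)⁻¹ : ℝ) : ℂ)) := by
    congr 1; ext t; simp
  have hmP : Integrable (fun t : ℝ => (D t).re * (1 + t^2)⁻¹) := by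
    refine hD.re.congr (ae_of_all _ fun t => ?_)
    simp only [RCLike.re_to_complex]
    rw [re_mul_ofReal]
  have hMi : Integrable (fun t : ℝ => (α + L t - 2 * (D t).re) * (1 + t^2)⁻¹) := by
    refine (((hPi.const_mul α).add hLi).sub (hmP.const_mul 2)).congr (ae_of_all _ fun t => ?_)
    simp; ring
  have hMint : ∫ t : ℝ, (α + L t - 2 * (D t).re) * (1 + t^2)⁻¹ = α * Real.pi + (∫ t : ℝ, L t * (1 + t^2)⁻¹)
      - 2 * (∫ t : ℝ, (D t * (((1 + t^2)⁻¹ : ℝ) : ℂ))).re := by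
    have h1 : (∫ t : ℝ, (D t * (((1 + t^2)⁻¹ : ℝ) : ℂ))).re = ∫ t : ℝ, (D t).re * (1 + t^2)⁻¹ := by
      have := integral_re hD
      simp only [RCLike.re_to_complex] at this
      rw [← this]
      congr 1; ext t; rw [re_mul_ofReal]
    have hAL : Integrable (fun t : ℝ => α * (1 + t^2)⁻¹ + L t * (1 + t^2)⁻¹) := (hPi.const_mul α).add hLi
    rw [h1, ← integral_univ_inv_one_add_sq, ← integral_const_mul, ← integral_const_mul,
      ← integral_add (hPi.const_mul α) hLi, ← integral_sub hAL (hmP.const_mul 2)]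
    congr 1; ext t; ring
  have hPc : Integrable (fun t : ℝ => (((1 + t^2)⁻¹ : ℝ) : ℂ)) := hPi.ofReal
  have hLc : Integrable (fun t : ℝ => ((L t * (1 + t^2)⁻¹ : ℝ) : ℂ)) := hLi.ofReal
  have hMc : Integrable (fun t : ℝ => (((α + L t - 2 * (D t).re) * (1 + t^2)⁻¹ : ℝ) : ℂ)) := hMi.ofReal
  have key : (∫ t : ℝ, D t * exp (t * I * u) * (((1 + t^2)⁻¹ : ℝ) : ℂ)) +
      (starRingEnd ℂ) (∫ t : ℝ, D t * exp (t * I * (-u : ℝ)) * (((1 + t^2)⁻¹ : ℝ) : ℂ)) =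
      α * (∫ t : ℝ, exp (t * I * u) * (((1 + t^2)⁻¹ : ℝ) : ℂ)) +
      (∫ t : ℝ, exp (t * I * u) * ((L t * (1 + t^2)⁻¹ : ℝ) : ℂ)) -
      (∫ t : ℝ, exp (t * I * u) * (((α + L t - 2 * (D t).re) * (1 + t^2)⁻¹ : ℝ) : ℂ)) := by
    have hAL : Integrable (fun t : ℝ => (α : ℂ) * (exp (t * I * u) * (((1 + t^2)⁻¹ : ℝ) : ℂ)) + exp (t * I * u) * ((L t * (1 + t^2)⁻¹ : ℝ) : ℂ)) :=
      ((hmul _ u hPc).const_mul _).add (hmul _ u hLc)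
    rw [e1, e2, ← integral_add (hmul _ u hD) (hmul _ u hDc), ← integral_const_mul,
      ← integral_add ((hmul _ u hPc).const_mul (α:ℂ)) (hmul _ u hLc),
      ← integral_sub hAL (hmul _ u hMc)]
    congr 1; ext t
    have : (starRingEnd ℂ) (D t) = 2 * ((D t).re : ℂ) - D t := by
      have := Complex.add_conj (D t)
      rw [← sub_eq_iff_eq_add'.mpr this.symm]; push_cast; ring
    rw [this]; push_cast; ring
  have b1 : ‖(α:ℂ) * (∫ t : ℝ, exp (t * I * u) * (((1 + t^2)⁻¹ : ℝ) : ℂ))‖ = α * (Real.pi * Real.exp (-|u|)) := by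
    have := gw_fourier u
    have h2 : (∫ t : ℝ, exp (t * I * u) * (((1 + t^2)⁻¹ : ℝ) : ℂ)) = ∫ t : ℝ, exp (t * I * u) / (1 - (t * I)^2) := by
      congr 1; ext t
      rw [div_eq_mul_inv]
      congr 1
      push_cast
      rw [mul_pow, I_sq]; ring
    rw [h2, this, norm_mul, norm_real, norm_real, Real.norm_of_nonneg hα, Real.norm_of_nonneg (by positivity)]
  have b2 : ‖∫ t : ℝ, exp (t * I * u) * ((L t * (1 + t^2)⁻¹ : ℝ) : ℂ)‖ ≤ ∫ t : ℝ, L t * (1 + t^2)⁻¹ := by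
    refine norm_integral_le_of_norm_le hLi (ae_of_all _ fun t => ?_)
    rw [norm_mul, hexp, one_mul, norm_real, Real.norm_of_nonneg]
    have := hL0 t
    positivity
  have b3 : ‖∫ t : ℝ, exp (t * I * u) * (((α + L t - 2 * (D t).re) * (1 + t^2)⁻¹ : ℝ) : ℂ)‖ ≤
      ∫ t : ℝ, (α + L t - 2 * (D t).re) * (1 + t^2)⁻¹ := by
    refine norm_integral_le_of_norm_le hMi (ae_of_all _ fun t => ?_)
    rw [norm_mul, hexp, one_mul, norm_real, Real.norm_of_nonneg]
    have := hM t
    have h3 : 0 ≤ α + L t - 2 * (D t).re := by linarith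
    positivity
  rw [hMint] at b3
  have b4 : -(∫ t : ℝ, (D t * (((1 + t^2)⁻¹ : ℝ) : ℂ))).re ≤ ‖∫ t : ℝ, (D t * (((1 + t^2)⁻¹ : ℝ) : ℂ))‖ :=
    (neg_le_abs _).trans (abs_re_le_norm _)
  rw [e0]
  have k2 := eq_sub_of_add_eq key
  rw [k2]
  refine (norm_sub_le _ _).trans ?_
  rw [Complex.norm_conj]
  have t1 := norm_sub_le (α * (∫ t : ℝ, exp (t * I * u) * (((1 + t^2)⁻¹ : ℝ) : ℂ)) +
      (∫ t : ℝ, exp (t * I * u) * ((L t * (1 + t^2)⁻¹ : ℝ) : ℂ))) (∫ t : ℝ, exp (t * I * u) * (((α + L t - 2 * (D t).re) * (1 + t^2)⁻¹ : ℝ) : ℂ))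
  have t2 := norm_add_le (α * (∫ t : ℝ, exp (t * I * u) * (((1 + t^2)⁻¹ : ℝ) : ℂ))) (∫ t : ℝ, exp (t * I * u) * ((L t * (1 + t^2)⁻¹ : ℝ) : ℂ))
  linarith

theorem gw_log_one_add_sq (w : ℝ) (hw : 0 ≤ w) : Real.log (1 + w^4) ≤ 2 * w := by
  rw [← Real.log_exp (2*w)]
  apply Real.log_le_log (by positivity)
  have := Real.sum_le_exp_of_nonneg (x := 2*w) (by positivity) 6
  refine le_trans ?_ this
  simp only [Finset.sum_range_succ, Finset.sum_range_zero, Nat.factorial]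
  norm_num
  rcases le_total w 4 with h | h
  · have : 0 ≤ w^3 * (4-w) := by have : 0 ≤ 4 - w := by linarith
                                 positivity
    nlinarith [pow_nonneg hw 5, pow_nonneg hw 2]
  · have : 0 ≤ w^4 * (w-4) := by have : 0 ≤ w-4 := by linarith
                                 positivity
    nlinarith [pow_nonneg hw 4, pow_nonneg hw 3, pow_nonneg hw 2]

theorem gw_sqrt_int : Integrable (fun t : ℝ => √|t| * (1 + t^2)⁻¹) ∧ ∫ t : ℝ, √|t| * (1 + t^2)⁻¹ ≤ 16/3 := by
  set f : ℝ → ℝ := fun t => √t * (1 + t^2)⁻¹ with hf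
  have hfe : (fun t : ℝ => √|t| * (1 + t^2)⁻¹) = fun t => f |t| := by
    ext t; simp [hf]
  have hcont : Continuous f := by
    refine Real.continuous_sqrt.mul (Continuous.inv₀ (by fun_prop) fun t => by positivity)
  have i2 : IntegrableOn (fun t : ℝ => t ^ (-(3/2) : ℝ)) (Set.Ioi 1) := integrableOn_Ioi_rpow_of_lt (by norm_num) one_pos
  have hle2 : ∀ t ∈ Set.Ioi (1:ℝ), f t ≤ t ^ (-(3/2) : ℝ) := by
    intro t ht
    have ht : 1 < t := ht
    have : t ^ (-(3/2) : ℝ) = √t * (t^2)⁻¹ := by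
      rw [Real.sqrt_eq_rpow, ← Real.rpow_natCast, ← Real.rpow_neg (by linarith), ← Real.rpow_add (by linarith)]
      norm_num
    rw [this]
    have h5 : (1 + t^2)⁻¹ ≤ (t^2)⁻¹ := inv_anti₀ (by positivity) (by linarith)
    exact mul_le_mul_of_nonneg_left h5 (Real.sqrt_nonneg t)
  have hnn : ∀ t, 0 ≤ f t := fun t => by positivity
  have j2 : IntegrableOn f (Set.Ioi 1) := by
    refine i2.mono' hcont.aestronglyMeasurable ?_
    filter_upwards [ae_restrict_mem measurableSet_Ioi] with t ht
    rw [Real.norm_of_nonneg (hnn t)]; exact hle2 t ht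
  have j1 : IntegrableOn f (Set.Ioc 0 1) := hcont.integrableOn_Ioc
  have j : IntegrableOn f (Set.Ioi 0) := by
    rw [← Set.Ioc_union_Ioi_eq_Ioi zero_le_one]; exact j1.union j2
  rw [hfe]
  have jn : IntegrableOn (fun t => f |t|) (Set.Iic 0) := by
    have j' : IntegrableOn f (Set.Ici 0) := by
      rw [← Set.Icc_union_Ioi_eq_Ici zero_le_one]
      exact (hcont.integrableOn_Icc).union j2
    have h6 : IntegrableOn (fun t => f (-t)) (Set.Iic 0) := by
      have := (integrable_indicator_iff measurableSet_Ici).mpr j'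
      have := this.comp_neg
      rw [← integrable_indicator_iff measurableSet_Iic]
      refine this.congr (ae_of_all _ fun t => ?_)
      simp [Set.indicator]
    refine h6.congr_fun (fun t ht => ?_) measurableSet_Iic
    have ht : t ≤ 0 := ht
    simp only [abs_of_nonpos ht]
  have jp : IntegrableOn (fun t => f |t|) (Set.Ioi 0) := by
    refine j.congr_fun (fun t ht => ?_) measurableSet_Ioi
    have ht : 0 < t := ht
    simp only [abs_of_pos ht]
  refine ⟨by rw [← integrableOn_univ, ← Set.Iic_union_Ioi (a := (0:ℝ))]; exact jn.union jp, ?_⟩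
  rw [integral_comp_abs (f := f)]
  rw [← Set.Ioc_union_Ioi_eq_Ioi zero_le_one, setIntegral_union (Set.Ioc_disjoint_Ioi le_rfl) measurableSet_Ioi j1 j2]
  have k2 : ∫ t in Set.Ioi 1, f t ≤ 2 := by
    refine (setIntegral_mono_on j2 i2 measurableSet_Ioi hle2).trans ?_
    rw [integral_Ioi_rpow_of_lt (by norm_num) one_pos]; norm_num
  have k1 : ∫ t in Set.Ioc 0 1, f t ≤ 2/3 := by
    rw [← intervalIntegral.integral_of_le zero_le_one]
    have : ∫ t in (0:ℝ)..1, t ^ (1/2:ℝ) = 2/3 := by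
      rw [integral_rpow (by left; norm_num)]; norm_num
    rw [← this]
    refine intervalIntegral.integral_mono_on zero_le_one (hcont.intervalIntegrable _ _)
      (intervalIntegral.intervalIntegrable_rpow' (by norm_num)) ?_
    intro t ht
    rw [← Real.sqrt_eq_rpow, hf]
    have : (1 + t^2)⁻¹ ≤ 1 := inv_le_one_of_one_le₀ (by nlinarith [sq_nonneg t])
    nlinarith [Real.sqrt_nonneg t]
  linarith

theorem gw_logint (w : ℝ) (h1 : 1 ≤ w) (h2 : w ≤ 3.6) :
    (∀ t : ℝ, 0 ≤ Real.log ‖(w : ℂ) + t * I‖) ∧ Integrable (fun t : ℝ => Real.log ‖(w : ℂ) + t * I‖ * (1 + t^2)⁻¹) ∧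
    2 * ∫ t : ℝ, Real.log ‖(w : ℂ) + t * I‖ * (1 + t^2)⁻¹ ≤ Real.pi * 4.36 := by
  have hre : ∀ t : ℝ, 1 ≤ ‖(w : ℂ) + t * I‖ := by
    intro t
    have := abs_re_le_norm ((w : ℂ) + t * I)
    simp at this
    exact (h1.trans (le_abs_self _)).trans this
  have h0 : ∀ t : ℝ, 0 ≤ Real.log ‖(w : ℂ) + t * I‖ := fun t => Real.log_nonneg (hre t)
  have hPi : Integrable (fun t : ℝ => (1 + t^2)⁻¹) := integrable_inv_one_add_sq
  have hb : ∀ t : ℝ, Real.log ‖(w : ℂ) + t * I‖ ≤ Real.log 3.6 + (1/√3.6) * √|t| := by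
    intro t
    set v := √(|t|/3.6) with hv
    have hv0 : 0 ≤ v := Real.sqrt_nonneg _
    have hv2 : v^2 = |t|/3.6 := Real.sq_sqrt (by positivity)
    have hv4 : v^4 = t^2/3.6^2 := by
      rw [show v^4 = (v^2)^2 by ring, hv2, div_pow, sq_abs]
    have hn : ‖(w : ℂ) + t * I‖^2 ≤ 3.6^2 * (1 + v^4) := by
      rw [← Complex.normSq_eq_norm_sq, hv4]
      simp only [Complex.normSq_apply, add_re, ofReal_re, mul_re, I_re, mul_zero, ofReal_im, I_im, mul_one, sub_self, add_zero, add_im, mul_im, zero_add]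
      have : (3.6:ℝ)^2 * (1 + t^2/3.6^2) = 3.6^2 + t^2 := by field_simp
      rw [this]
      nlinarith
    have := Real.log_le_log (by have := hre t; positivity) hn
    rw [Real.log_pow, Real.log_mul (by norm_num) (by positivity), Real.log_pow] at this
    have h3 := gw_log_one_add_sq v hv0
    have h4 : v = (1/√3.6) * √|t| := by rw [hv, Real.sqrt_div (abs_nonneg t)]; ring
    push_cast at this
    rw [← h4]
    linarith
  obtain ⟨hsi, hsb⟩ := gw_sqrt_int
  have hgi : Integrable (fun t : ℝ => (Real.log 3.6 + (1/√3.6) * √|t|) * (1 + t^2)⁻¹) := by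
    refine ((hPi.const_mul (Real.log 3.6)).add (hsi.const_mul (1/√3.6))).congr (ae_of_all _ fun t => ?_)
    simp; ring
  have hcont : Continuous (fun t : ℝ => Real.log ‖(w : ℂ) + t * I‖ * (1 + t^2)⁻¹) := by
    refine Continuous.mul (Continuous.log (by fun_prop) fun t => by have := hre t; linarith) (Continuous.inv₀ (by fun_prop) fun t => by positivity)
  have hi : Integrable (fun t : ℝ => Real.log ‖(w : ℂ) + t * I‖ * (1 + t^2)⁻¹) := by
    refine hgi.mono' hcont.aestronglyMeasurable (ae_of_all _ fun t => ?_)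
    have := h0 t
    rw [Real.norm_of_nonneg (by positivity)]
    gcongr
    exact hb t
  refine ⟨h0, hi, ?_⟩
  have hI : ∫ t : ℝ, Real.log ‖(w : ℂ) + t * I‖ * (1 + t^2)⁻¹ ≤ Real.log 3.6 * Real.pi + (1/√3.6) * (16/3) := by
    refine (integral_mono hi hgi fun t => by dsimp only; gcongr; exact hb t).trans ?_
    have : ∫ t : ℝ, (Real.log 3.6 + (1/√3.6) * √|t|) * (1 + t^2)⁻¹ = Real.log 3.6 * Real.pi + (1/√3.6) * ∫ t : ℝ, √|t| * (1 + t^2)⁻¹ := by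
      rw [← integral_univ_inv_one_add_sq, ← integral_const_mul, ← integral_const_mul,
        ← integral_add (hPi.const_mul _) (hsi.const_mul _)]
      congr 1; ext t; ring
    rw [this]
    gcongr
  have hl : Real.log 3.6 ≤ 1.2814 := by
    rw [Real.log_le_iff_le_exp (by norm_num)]
    have h := Real.sum_le_exp_of_nonneg (x := 1.2814) (by norm_num) 12
    refine le_trans ?_ h
    simp only [Finset.sum_range_succ, Finset.sum_range_zero, Nat.factorial]
    norm_num
  have hs : 1/√3.6 ≤ 0.5271 := by
    rw [div_le_iff₀ (by positivity)]
    have : (1.8973:ℝ) ≤ √3.6 := Real.le_sqrt_of_sq_le (by norm_num)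
    nlinarith
  have := Real.pi_gt_d4
  nlinarith

end

section
open Complex Filter Topology MeasureTheory

theorem gw_LSeries_real (f : ℕ → ℝ) : LSeries (fun n => (f n : ℂ)) ((3/2 : ℝ) : ℂ) = ((∑' n : ℕ, f n / (n:ℝ)^(3/2:ℝ) : ℝ) : ℂ) := by
  unfold LSeries
  rw [ofReal_tsum]
  congr 1; ext n
  rcases Nat.eq_zero_or_pos n with rfl | hn
  · simp
  · rw [LSeries.term_of_ne_zero hn.ne', ofReal_div (f n), ofReal_cpow (Nat.cast_nonneg n), ofReal_natCast]

theorem gw_zeta_lower : 2 ≤ ∑' n : ℕ, (1:ℝ) / (n:ℝ)^(3/2:ℝ) := by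
  have hs : Summable (fun n : ℕ => (1:ℝ) / (n:ℝ)^(3/2:ℝ)) := Real.summable_one_div_nat_rpow.mpr (by norm_num)
  have hpart : ∀ N : ℕ, 2 - 2 / √(N+1) ≤ ∑ n ∈ Finset.range (N+1), (1:ℝ) / (n:ℝ)^(3/2:ℝ) := by
    intro N
    induction N with
    | zero => simp
    | succ N ih =>
      rw [Finset.sum_range_succ]
      have h1 : ((N+1 : ℕ):ℝ)^(3/2:ℝ) = √(N+1)^3 := by
        rw [Real.sqrt_eq_rpow, ← Real.rpow_natCast, ← Real.rpow_mul (by positivity)]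
        push_cast; norm_num
      rw [h1]
      push_cast
      set a := √((N:ℝ)+1) with ha
      set b := √((N:ℝ)+1+1) with hb
      have ha0 : 0 < a := Real.sqrt_pos.mpr (by positivity)
      have hab : a ≤ b := Real.sqrt_le_sqrt (by linarith)
      have ha2 : a^2 = N+1 := Real.sq_sqrt (by positivity)
      have hb2 : b^2 = N+1+1 := Real.sq_sqrt (by positivity)
      have hb0 : 0 < b := by linarith
      have : 2/a - 2/b ≤ 1/a^3 := by
        have e : 2/a - 2/b = 2/(a*b*(a+b)) := by
          field_simp
          nlinarith
        rw [e, div_le_div_iff₀ (by positivity) (by positivity)]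
        have : 2*a^3 ≤ a*b*(a+b) := by nlinarith [mul_pos ha0 hb0]
        linarith
      linarith
  have ht : Tendsto (fun N : ℕ => 2 - 2 / √((N:ℝ)+1)) atTop (𝓝 (2 - 0)) := by
    refine tendsto_const_nhds.sub ?_
    refine Tendsto.const_div_atTop ?_ 2
    exact Real.tendsto_sqrt_atTop.comp (tendsto_atTop_add_const_right _ _ tendsto_natCast_atTop_atTop)
  rw [sub_zero] at ht
  exact le_of_tendsto ht (Eventually.of_forall fun N => (hpart N).trans (hs.sum_le_tsum _ fun n _ => by positivity))

theorem gw_five_fourths : Summable (fun n : ℕ => (if n ≤ 1 then 0 else (1:ℝ) / (n:ℝ)^(5/4:ℝ))) ∧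
    ∑' n : ℕ, (if n ≤ 1 then 0 else (1:ℝ) / (n:ℝ)^(5/4:ℝ)) ≤ 4 := by
  have hpart : ∀ N : ℕ, ∑ n ∈ Finset.range (N+2), (if n ≤ 1 then 0 else (1:ℝ) / (n:ℝ)^(5/4:ℝ)) ≤ 4 - 4/((N:ℝ)+1)^(1/4:ℝ) := by
    intro N
    induction N with
    | zero => simp [Finset.sum_range_succ]
    | succ N ih =>
      rw [Finset.sum_range_succ, if_neg (by omega)]
      have h1 : ((N+1+1 : ℕ):ℝ)^(5/4:ℝ) = (((N:ℝ)+1+1)^(1/4:ℝ))^5 := by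
        rw [← Real.rpow_natCast, ← Real.rpow_mul (by positivity)]
        push_cast; norm_num
      rw [h1]
      push_cast
      set a := ((N:ℝ)+1)^(1/4:ℝ) with ha
      set b := ((N:ℝ)+1+1)^(1/4:ℝ) with hb
      have ha0 : 0 < a := by positivity
      have hab : a ≤ b := Real.rpow_le_rpow (by positivity) (by linarith) (by norm_num)
      have ha2 : a^4 = N+1 := by
        rw [ha, ← Real.rpow_natCast, ← Real.rpow_mul (by positivity)]; norm_num
      have hb2 : b^4 = N+1+1 := by
        rw [hb, ← Real.rpow_natCast, ← Real.rpow_mul (by positivity)]; norm_num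
      have hb0 : 0 < b := by linarith
      have : 1/b^5 ≤ 4/a - 4/b := by
        have e : 4/a - 4/b = 4/(a*b*((a+b)*(a^2+b^2))) := by
          field_simp
          nlinarith
        rw [e, div_le_div_iff₀ (by positivity) (by positivity)]
        have h3 : a*b*((a+b)*(a^2+b^2)) ≤ b*b*((b+b)*(b^2+b^2)) := by gcongr
        nlinarith
      linarith
  have hb : ∀ N : ℕ, ∑ n ∈ Finset.range N, (if n ≤ 1 then 0 else (1:ℝ) / (n:ℝ)^(5/4:ℝ)) ≤ 4 := by
    intro N
    refine (Finset.sum_le_sum_of_subset_of_nonneg (Finset.range_subset_range.mpr (by omega : N ≤ N+2)) fun n _ _ => by positivity).trans ((hpart N).trans ?_)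
    have : 0 ≤ 4/((N:ℝ)+1)^(1/4:ℝ) := by positivity
    linarith
  have hn : ∀ n : ℕ, 0 ≤ (if n ≤ 1 then 0 else (1:ℝ) / (n:ℝ)^(5/4:ℝ)) := fun n => by positivity
  exact ⟨summable_of_sum_range_le hn hb, Real.tsum_le_of_sum_range_le hn hb⟩

theorem gw_Q : Summable (fun n : ℕ => ArithmeticFunction.vonMangoldt n / (n:ℝ)^(3/2:ℝ)) ∧
    ∑' n : ℕ, ArithmeticFunction.vonMangoldt n / (n:ℝ)^(3/2:ℝ) ≤ 2.945 := by
  have hre : 1 < (((3/2:ℝ) : ℂ)).re := by norm_num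
  have hsΛ := ArithmeticFunction.LSeriesSummable_vonMangoldt hre
  have hsum : Summable (fun n : ℕ => ArithmeticFunction.vonMangoldt n / (n:ℝ)^(3/2:ℝ)) := by
    have := hsΛ.norm
    refine this.congr fun n => ?_
    rw [LSeries.norm_term_eq]
    rcases Nat.eq_zero_or_pos n with rfl | hn
    · simp
    · rw [if_neg hn.ne', norm_real, Real.norm_of_nonneg ArithmeticFunction.vonMangoldt_nonneg]
      norm_num
  refine ⟨hsum, ?_⟩
  have hconv := LSeries_convolution' hsΛ (ArithmeticFunction.LSeriesSummable_zeta_iff.mpr hre)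
  rw [ArithmeticFunction.convolution_vonMangoldt_zeta] at hconv
  have e1 : LSeries (fun n => Complex.log n) ((3/2 : ℝ) : ℂ) = ((∑' n : ℕ, Real.log n / (n:ℝ)^(3/2:ℝ) : ℝ) : ℂ) := by
    rw [← gw_LSeries_real]
    congr 1; ext n; rw [natCast_log]
  have e2 : LSeries (fun n => ((ArithmeticFunction.zeta n : ℕ) : ℂ)) ((3/2 : ℝ) : ℂ) = ((∑' n : ℕ, 1 / (n:ℝ)^(3/2:ℝ) : ℝ) : ℂ) := by
    rw [← gw_LSeries_real]
    apply LSeries_congr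
    intro n hn
    simp [ArithmeticFunction.zeta_apply, hn]
  rw [e1, e2, gw_LSeries_real] at hconv
  have hc : (∑' n : ℕ, Real.log n / (n:ℝ)^(3/2:ℝ)) = (∑' n : ℕ, ArithmeticFunction.vonMangoldt n / (n:ℝ)^(3/2:ℝ)) * ∑' n : ℕ, 1 / (n:ℝ)^(3/2:ℝ) := by
    exact_mod_cast hconv
  obtain ⟨h5, h6⟩ := gw_five_fourths
  have hlog : (∑' n : ℕ, Real.log n / (n:ℝ)^(3/2:ℝ)) ≤ 4 / Real.exp 1 * 4 := by
    have hle : ∀ n : ℕ, Real.log n / (n:ℝ)^(3/2:ℝ) ≤ 4 / Real.exp 1 * (if n ≤ 1 then 0 else (1:ℝ) / (n:ℝ)^(5/4:ℝ)) := by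
      intro n
      split_ifs with h
      · interval_cases n <;> simp
      · have hn : (0:ℝ) < n := by exact_mod_cast (by omega : 0 < n)
        have hl : Real.log n ≤ 4 / Real.exp 1 * (n:ℝ)^(1/4:ℝ) := by
          have := Real.add_one_le_exp (Real.log n / 4 - 1)
          rw [Real.exp_sub] at this
          have h7 : Real.exp (Real.log n / 4) = (n:ℝ)^(1/4:ℝ) := by
            rw [Real.rpow_def_of_pos hn]; congr 1; ring
          rw [h7] at this
          have h8 : 4 / Real.exp 1 * (n:ℝ)^(1/4:ℝ) = 4 * ((n:ℝ)^(1/4:ℝ) / Real.exp 1) := by ring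
          rw [h8]; linarith
        have h9 : (n:ℝ)^(3/2:ℝ) = (n:ℝ)^(1/4:ℝ) * (n:ℝ)^(5/4:ℝ) := by
          rw [← Real.rpow_add hn]; norm_num
        rw [h9, div_le_iff₀ (by positivity)]
        have h10 : (n:ℝ)^(5/4:ℝ) ≠ 0 := by positivity
        calc _ ≤ _ := hl
          _ = _ := by field_simp
    have hs2 := h5.mul_left (4 / Real.exp 1)
    have hs1 : Summable fun n : ℕ => Real.log n / (n:ℝ)^(3/2:ℝ) :=
      Summable.of_nonneg_of_le (fun n => by have := Real.log_natCast_nonneg n; positivity) hle hs2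
    refine (hs1.tsum_le_tsum hle hs2).trans ?_
    rw [tsum_mul_left]
    gcongr
  have he : 4 / Real.exp 1 * 4 ≤ 5.89 := by
    rw [div_mul_eq_mul_div, div_le_iff₀ (Real.exp_pos 1)]
    have := Real.exp_one_gt_d9
    linarith
  have hz := gw_zeta_lower
  have hQ0 : 0 ≤ ∑' n : ℕ, ArithmeticFunction.vonMangoldt n / (n:ℝ)^(3/2:ℝ) :=
    tsum_nonneg fun n => div_nonneg ArithmeticFunction.vonMangoldt_nonneg (by positivity)
  nlinarith

end

section
open Complex Filter Topology MeasureTheory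

noncomputable def gwc (p : ℕ) (χ : DirichletCharacter ℂ p) (ε : ℝ) (n : ℕ) : ℂ :=
  χ n * ((ArithmeticFunction.vonMangoldt n * (n:ℝ)^(-(1/2+ε)) : ℝ) : ℂ)

theorem gwc_norm_le (p : ℕ) (χ : DirichletCharacter ℂ p) (ε : ℝ) (n : ℕ) :
    ‖gwc p χ ε n‖ ≤ ArithmeticFunction.vonMangoldt n * (n:ℝ)^(-(1/2+ε)) := by
  have h : 0 ≤ ArithmeticFunction.vonMangoldt n * (n:ℝ)^(-(1/2+ε)) :=
    mul_nonneg ArithmeticFunction.vonMangoldt_nonneg (by positivity)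
  unfold gwc
  rw [norm_mul, norm_real, Real.norm_of_nonneg h]
  exact mul_le_of_le_one_left h (χ.norm_le_one _)

theorem gwc_term_le (p : ℕ) (χ : DirichletCharacter ℂ p) (ε : ℝ) (hε : 0 ≤ ε) (n : ℕ) (u : ℝ) :
    ‖gwc p χ ε n * ((Real.exp (-|u - Real.log n|) : ℝ) : ℂ)‖ ≤ Real.exp u * (ArithmeticFunction.vonMangoldt n / (n:ℝ)^(3/2:ℝ)) := by
  rw [norm_mul, norm_real, Real.norm_of_nonneg (Real.exp_pos _).le]
  rcases Nat.eq_zero_or_pos n with rfl | hn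
  · simp [gwc]
  · have hn0 : (0:ℝ) < n := by exact_mod_cast hn
    have hn1 : (1:ℝ) ≤ n := by exact_mod_cast hn
    have h1 : Real.exp (-|u - Real.log n|) ≤ Real.exp u * (n:ℝ)^(-1:ℝ) := by
      rw [Real.rpow_def_of_pos hn0, ← Real.exp_add]
      apply Real.exp_le_exp.mpr
      have := neg_abs_le (u - Real.log n)
      have := le_abs_self (u - Real.log n)
      have := neg_le_abs (u - Real.log n)
      linarith
    have h2 : (n:ℝ)^(-(1/2+ε)) ≤ (n:ℝ)^(-(1/2):ℝ) := Real.rpow_le_rpow_of_exponent_le hn1 (by linarith)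
    have hΛ : 0 ≤ ArithmeticFunction.vonMangoldt n := ArithmeticFunction.vonMangoldt_nonneg
    have h3 : ‖gwc p χ ε n‖ ≤ ArithmeticFunction.vonMangoldt n * (n:ℝ)^(-(1/2):ℝ) :=
      (gwc_norm_le p χ ε n).trans (by gcongr)
    calc _ ≤ (ArithmeticFunction.vonMangoldt n * (n:ℝ)^(-(1/2):ℝ)) * (Real.exp u * (n:ℝ)^(-1:ℝ)) := by gcongr
      _ = _ := by
        have : (n:ℝ)^(-(3/2):ℝ) = (n:ℝ)^(-(1/2):ℝ) * (n:ℝ)^(-1:ℝ) := by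
          rw [← Real.rpow_add hn0]; norm_num
        rw [div_eq_mul_inv (ArithmeticFunction.vonMangoldt n), ← Real.rpow_neg hn0.le, this]; ring

theorem gwc_summable (p : ℕ) (χ : DirichletCharacter ℂ p) (ε : ℝ) (hε : 0 ≤ ε) (u : ℝ) :
    Summable (fun n : ℕ => gwc p χ ε n * ((Real.exp (-|u - Real.log n|) : ℝ) : ℂ)) :=
  Summable.of_norm_bounded (gw_Q.1.mul_left (Real.exp u)) fun n => gwc_term_le p χ ε hε n u

theorem gwc_tsum_le (p : ℕ) (χ : DirichletCharacter ℂ p) (ε : ℝ) (hε : 0 ≤ ε) (u : ℝ) :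
    ‖∑' n : ℕ, gwc p χ ε n * ((Real.exp (-|u - Real.log n|) : ℝ) : ℂ)‖ ≤ Real.exp u * 2.945 := by
  refine (tsum_of_norm_bounded (gw_Q.1.mul_left (Real.exp u)).hasSum fun n => gwc_term_le p χ ε hε n u).trans ?_
  rw [tsum_mul_left]
  gcongr
  exact gw_Q.2

theorem gw_S_bound (p : ℕ) [Fact p.Prime] [NeZero p] (hp4 : 4 ≤ p) (χ : DirichletCharacter ℂ p) (hχ : χ ≠ 1)
    (hG : ∀ s : ℂ, DirichletCharacter.LFunction χ s = 0 → 0 < s.re → s.re < 1 → s.re = 1/2)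
    (ε : ℝ) (hε : 0 < ε) (hε' : ε ≤ 1/10) (u : ℝ) (hu : 0 ≤ u) :
    ‖∑' n : ℕ, gwc p χ ε n * ((Real.exp (-|u - Real.log n|) : ℝ) : ℂ)‖ ≤
      Real.log (p / Real.pi) * (1 + Real.exp (-u)) + 10.25 + Real.exp (-u) * 2.945 := by
  set F := DirichletCharacter.LFunction χ with hFdef
  have hF : Differentiable ℂ F := DirichletCharacter.differentiable_LFunction hχ
  have hnz : ∀ s : ℂ, 1/2 < s.re → F s ≠ 0 := by
    intro s hs h
    rcases lt_or_ge s.re 1 with h1 | h1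
    · have := hG s h (by linarith) h1
      linarith
    · exact DirichletCharacter.LFunction_ne_zero_of_one_le_re χ (Or.inl hχ) h1 h
  obtain ⟨A, hA⟩ := gw_L_bound p χ hχ
  obtain ⟨A2, c, hc, hu2, hl⟩ := gw_L_upper_lower p χ
  obtain ⟨k, hk0, hk1, hfe⟩ := gw_hfe p χ hχ
  have hpi := Real.pi_pos
  have hp0 : (0:ℝ) < p := by exact_mod_cast (by omega : 0 < p)
  have ha : 0 < (p:ℝ)/Real.pi := by positivity
  have hα : 0 ≤ Real.log (p/Real.pi) := by
    apply Real.log_nonneg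
    rw [le_div_iff₀ hpi]
    have : (4:ℝ) ≤ p := by exact_mod_cast hp4
    linarith [Real.pi_le_four]
  have hre := gw_re_ge F hF hnz A c A2 hc hA hl hu2 (p/Real.pi) k ha hk0 hfe
  obtain ⟨C, hC, hCb⟩ := gw_growth F hF hnz A c hc hA hl ε hε (by linarith)
  set σ : ℝ := 1/2 + ε with hσ
  set D : ℂ → ℂ := fun z => -(deriv F (σ + z) / F (σ + z)) with hD
  have hDd : ∀ z : ℂ, 0 ≤ z.re → z.re ≤ 3/4 → DifferentiableAt ℂ D z := by
    intro z hz _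
    have h1 : Differentiable ℂ (deriv F) := hF.deriv
    have hne : F (σ + z) ≠ 0 := hnz (σ + z) (by simp [hσ]; linarith)
    have e1 : DifferentiableAt ℂ (fun z => deriv F (σ + z)) z := (h1 (σ + z)).comp z (by fun_prop)
    have e2 : DifferentiableAt ℂ (fun z => F (σ + z)) z := (hF (σ + z)).comp z (by fun_prop)
    exact (e1.div e2 hne).neg
  have hDb : ∀ z : ℂ, 0 ≤ z.re → z.re ≤ 3/4 → ‖D z‖ ≤ (2 * C) * √(1 + ‖z‖) := by
    intro z hz hz'
    have h1 := (hCb (σ + z) (by simp [hσ]; linarith) (by simp [hσ]; linarith)).1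
    simp only [hD, norm_neg]
    refine h1.trans ?_
    have h2 : ‖(σ:ℂ) + z‖ ≤ 1 + ‖z‖ := by
      refine (norm_add_le _ _).trans ?_
      rw [norm_real, Real.norm_of_nonneg (by linarith)]
      linarith
    have h3 : √(1 + ‖(σ:ℂ) + z‖) ≤ 2 * √(1 + ‖z‖) := by
      rw [show (2:ℝ) = √4 by rw [show (4:ℝ) = 2^2 by norm_num, Real.sqrt_sq (by norm_num)], ← Real.sqrt_mul (by norm_num)]
      apply Real.sqrt_le_sqrt
      linarith [norm_nonneg z]
    nlinarith [Real.sqrt_nonneg (1 + ‖z‖)]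
  have hsum : Summable fun n : ℕ => ‖gwc p χ ε n‖ * Real.exp (-(3/4) * Real.log n) := by
    have h2 := (ArithmeticFunction.LSeriesSummable_vonMangoldt (s := ((5/4:ℝ):ℂ)) (by norm_num)).norm
    refine Summable.of_nonneg_of_le (fun n => by positivity) (fun n => ?_) h2
    rw [LSeries.norm_term_eq]
    rcases Nat.eq_zero_or_pos n with rfl | hn
    · simp [gwc]
    · have hn0 : (0:ℝ) < n := by exact_mod_cast hn
      have hn1 : (1:ℝ) ≤ n := by exact_mod_cast hn
      have hΛ : 0 ≤ ArithmeticFunction.vonMangoldt n := ArithmeticFunction.vonMangoldt_nonneg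
      rw [if_neg hn.ne', norm_real, Real.norm_of_nonneg hΛ, ofReal_re]
      have h3 : Real.exp (-(3/4) * Real.log n) = (n:ℝ)^(-(3/4):ℝ) := by
        rw [Real.rpow_def_of_pos hn0]; congr 1; ring
      rw [h3]
      have h4 : (n:ℝ)^(-(1/2+ε)) ≤ (n:ℝ)^(-(1/2):ℝ) := Real.rpow_le_rpow_of_exponent_le hn1 (by linarith)
      calc _ ≤ (ArithmeticFunction.vonMangoldt n * (n:ℝ)^(-(1/2):ℝ)) * (n:ℝ)^(-(3/4):ℝ) := by
              gcongr
              exact (gwc_norm_le p χ ε n).trans (by gcongr)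
        _ = _ := by
          rw [mul_assoc, ← Real.rpow_add hn0, div_eq_mul_inv (ArithmeticFunction.vonMangoldt n), ← Real.rpow_neg hn0.le]; norm_num
  have hGs : ∀ t : ℝ, D ((3/4 : ℝ) + t * I) = ∑' n : ℕ, gwc p χ ε n * exp (-((3/4 : ℝ) + t * I) * (Real.log n : ℝ)) := by
    intro t
    have h1 : 1 < ((σ:ℂ) + ((3/4 : ℝ) + t * I)).re := by simp [hσ]; linarith
    have h2 := DirichletCharacter.LSeries_twist_vonMangoldt_eq χ h1
    rw [← DirichletCharacter.deriv_LFunction_eq_deriv_LSeries χ h1, ← DirichletCharacter.LFunction_eq_LSeries χ h1] at h2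
    simp only [hD]
    rw [← neg_div, ← h2]
    unfold LSeries
    congr 1; ext n
    rcases Nat.eq_zero_or_pos n with rfl | hn
    · simp [gwc]
    · rw [LSeries.term_of_ne_zero hn.ne']
      have hn0 : (n:ℂ) ≠ 0 := by exact_mod_cast hn.ne'
      unfold gwc
      simp only [Pi.mul_apply]
      rw [div_eq_mul_inv, ← cpow_neg, neg_add, cpow_add _ _ hn0, ofReal_mul, ofReal_cpow (Nat.cast_nonneg n), ofReal_natCast,
        cpow_def_of_ne_zero hn0 (-((3/4 : ℝ) + t * I)), ← natCast_log, mul_comm (Complex.ofReal (Real.log n)) (-((3/4 : ℝ) + t * I))]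
      have es : (σ:ℂ) = 1/2 + ε := by rw [hσ]; push_cast; ring
      push_cast
      rw [es]
      ring_nf
  have hser := gw_series D (2*C) (by linarith) hDd hDb (gwc p χ ε) (fun n => Real.log n) hsum hGs
  have hgwH : ∀ (v t : ℝ), gwH D v (t * I) = D (t * I) * exp (t * I * v) * (((1 + t^2)⁻¹ : ℝ) : ℂ) := by
    intro v t
    unfold gwH
    rw [div_eq_mul_inv]
    congr 1
    push_cast
    rw [mul_pow, I_sq]; ring
  have hser' : ∀ v : ℝ, ‖∫ t : ℝ, D (t * I) * exp (t * I * v) * (((1 + t^2)⁻¹ : ℝ) : ℂ)‖ =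
      Real.pi * ‖∑' n : ℕ, gwc p χ ε n * ((Real.exp (-|v - Real.log n|) : ℝ) : ℂ)‖ := by
    intro v
    have := hser v
    simp_rw [hgwH] at this
    rw [this, norm_mul, norm_real, Real.norm_of_nonneg hpi.le]
  have hIntg : Integrable (fun t : ℝ => D (t * I) * (((1 + t^2)⁻¹ : ℝ) : ℂ)) := by
    have := gw_integ D (2*C) 0 (by linarith) hDd hDb 0 le_rfl (by norm_num)
    refine this.congr (ae_of_all _ fun t => ?_)
    dsimp only
    rw [ofReal_zero, zero_add, hgwH]; simp
  have hL := gw_logint (σ + k + 2) (by linarith) (by norm_num; linarith)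
  have hM : ∀ t : ℝ, 2 * (D (t * I)).re ≤ Real.log (p/Real.pi) + Real.log ‖((σ + k + 2 : ℝ) : ℂ) + t * I‖ := by
    intro t
    have h1 := hre (σ + t * I) (by simp [hσ]; linarith)
    have e : (σ:ℂ) + t * I + k + 2 = ((σ + k + 2 : ℝ) : ℂ) + t * I := by push_cast; ring
    rw [e] at h1
    have hne : ((σ + k + 2 : ℝ) : ℂ) + t * I ≠ 0 := by
      intro h; have := congrArg re h; simp at this; linarith
    rw [Real.log_mul ha.ne' (norm_ne_zero_iff.mpr hne)] at h1
    simp only [hD, neg_re]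
    linarith
  have fin := gw_pos (fun t => D (t * I)) _ _ hα hIntg hL.2.1 hL.1 hM u
  rw [hser', hser', hser'] at fin
  have q0 := gwc_tsum_le p χ ε hε.le 0
  have q1 := gwc_tsum_le p χ ε hε.le (-u)
  rw [Real.exp_zero] at q0
  rw [abs_of_nonneg hu] at fin
  have hL2 := hL.2.2
  have := mul_le_mul_of_nonneg_left q0 hpi.le
  have := mul_le_mul_of_nonneg_left q1 hpi.le
  rw [← mul_le_mul_iff_right₀ hpi]
  nlinarith

end

section
open Complex Filter Topology MeasureTheory

noncomputable def gww (x : ℝ) (n : ℕ) : ℝ :=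
  25/4 * Real.exp (-|Real.log (x/(25/4)) - Real.log n|) - Real.exp (-|Real.log x - Real.log n|)

theorem gw_exp_abs (a b : ℝ) (ha : 0 < a) (hab : a ≤ b) :
    Real.exp (-|Real.log a - Real.log b|) = a / b ∧ Real.exp (-|Real.log b - Real.log a|) = a / b := by
  have hb : 0 < b := by linarith
  have h := Real.log_le_log ha hab
  have : Real.exp (-|Real.log a - Real.log b|) = a / b := by
    rw [abs_of_nonpos (by linarith), neg_neg, Real.exp_sub, Real.exp_log ha, Real.exp_log hb]
  exact ⟨this, by rw [abs_sub_comm, this]⟩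

theorem gww_one (x : ℝ) (n : ℕ) (hn : 0 < n) (h : (n:ℝ) ≤ x/(25/4)) : gww x n = 609/16 * (n / x) := by
  have hn0 : (0:ℝ) < n := by exact_mod_cast hn
  have hx : 0 < x := by linarith
  unfold gww
  rw [(gw_exp_abs _ _ hn0 h).2, (gw_exp_abs (n:ℝ) x hn0 (by linarith)).2]
  field_simp; ring

theorem gww_two (x : ℝ) (n : ℕ) (hn : 0 < n) (h : x/(25/4) ≤ (n:ℝ)) (h2 : (n:ℝ) ≤ x) : gww x n = x / n - n / x := by
  have hn0 : (0:ℝ) < n := by exact_mod_cast hn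
  have hx : 0 < x := by linarith
  unfold gww
  rw [(gw_exp_abs _ _ (by positivity) h).1, (gw_exp_abs (n:ℝ) x hn0 (by linarith)).2]
  field_simp

theorem gww_three (x : ℝ) (n : ℕ) (hx : 0 < x) (h2 : x ≤ n) : gww x n = 0 := by
  have hn0 : (0:ℝ) < n := by linarith
  unfold gww
  rw [(gw_exp_abs _ _ (by positivity) (by linarith)).1, (gw_exp_abs x (n:ℝ) hx (by linarith)).1]
  field_simp; ring

theorem gw_fin_eq (p : ℕ) (χ : DirichletCharacter ℂ p) (ε : ℝ) (hε : 0 ≤ ε) (x : ℝ) (hx : 0 < x) :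
    ∑ n ∈ Finset.Ioc 0 ⌊x⌋₊, gwc p χ ε n * (gww x n : ℂ) =
     (25/4 : ℂ) * (∑' n : ℕ, gwc p χ ε n * ((Real.exp (-|Real.log (x/(25/4)) - Real.log n|) : ℝ) : ℂ)) -
      ∑' n : ℕ, gwc p χ ε n * ((Real.exp (-|Real.log x - Real.log n|) : ℝ) : ℂ) := by
  rw [← tsum_mul_left, ← Summable.tsum_sub ((gwc_summable p χ ε hε _).mul_left _) (gwc_summable p χ ε hε _),
    tsum_eq_sum (s := Finset.Ioc 0 ⌊x⌋₊)]
  · apply Finset.sum_congr rfl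
    intro n _
    unfold gww
    push_cast
    ring
  · intro n hn
    have e : (25/4 : ℂ) * (gwc p χ ε n * ((Real.exp (-|Real.log (x/(25/4)) - Real.log n|) : ℝ) : ℂ)) -
        gwc p χ ε n * ((Real.exp (-|Real.log x - Real.log n|) : ℝ) : ℂ) = gwc p χ ε n * (gww x n : ℂ) := by
      unfold gww
      push_cast
      ring
    rw [e]
    rcases Nat.eq_zero_or_pos n with rfl | h0
    · simp [gwc]
    · have : ⌊x⌋₊ < n := by
        by_contra hh
        exact hn (Finset.mem_Ioc.mpr ⟨h0, by omega⟩)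
      rw [gww_three x n hx ((Nat.lt_of_floor_lt this).le)]
      simp

theorem gw_F2_eps (p : ℕ) [Fact p.Prime] [NeZero p] (hp4 : 4 ≤ p) (χ : DirichletCharacter ℂ p) (hχ : χ ≠ 1)
    (hG : ∀ s : ℂ, DirichletCharacter.LFunction χ s = 0 → 0 < s.re → s.re < 1 → s.re = 1/2)
    (ε : ℝ) (hε : 0 < ε) (hε' : ε ≤ 1/10) (x : ℝ) (hx : 10^7 ≤ x) :
    ‖∑ n ∈ Finset.Ioc 0 ⌊x⌋₊, gwc p χ ε n * (gww x n : ℂ)‖ ≤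
      29/4 * (Real.log (p / Real.pi) * (1 + 1/10^6) + 10.251) := by
  have hx0 : 0 < x := by linarith
  have hpi := Real.pi_pos
  have hα : 0 ≤ Real.log (p/Real.pi) := by
    apply Real.log_nonneg
    rw [le_div_iff₀ hpi]
    have : (4:ℝ) ≤ p := by exact_mod_cast hp4
    linarith [Real.pi_le_four]
  have key : ∀ y : ℝ, 10^6 ≤ y → ‖∑' n : ℕ, gwc p χ ε n * ((Real.exp (-|Real.log y - Real.log n|) : ℝ) : ℂ)‖ ≤
      Real.log (p / Real.pi) * (1 + 1/10^6) + 10.251 := by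
    intro y hy
    have hy0 : 0 < y := by linarith
    have h1 := gw_S_bound p hp4 χ hχ hG ε hε hε' (Real.log y) (Real.log_nonneg (by linarith))
    have h2 : Real.exp (-Real.log y) ≤ 1/10^6 := by
      rw [Real.exp_neg, Real.exp_log hy0, ← one_div]
      exact one_div_le_one_div_of_le (by norm_num) hy
    have h3 : Real.log (p / Real.pi) * (1 + Real.exp (-Real.log y)) ≤ Real.log (p / Real.pi) * (1 + 1/10^6) := by gcongr
    linarith
  rw [gw_fin_eq p χ ε hε.le x hx0]
  refine (norm_sub_le _ _).trans ?_
  rw [norm_mul]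
  have h1 := key x (by linarith)
  have h2 := key (x/(25/4)) (by linarith)
  have : ‖(25/4:ℂ)‖ = 25/4 := by norm_num
  rw [this]
  linarith

theorem gw_F2 (p : ℕ) [Fact p.Prime] [NeZero p] (hp4 : 4 ≤ p) (χ : DirichletCharacter ℂ p) (hχ : χ ≠ 1)
    (hG : ∀ s : ℂ, DirichletCharacter.LFunction χ s = 0 → 0 < s.re → s.re < 1 → s.re = 1/2)
    (x : ℝ) (hx : 10^7 ≤ x) :
    ‖∑ n ∈ Finset.Ioc 0 ⌊x⌋₊, χ n * ((ArithmeticFunction.vonMangoldt n * (n:ℝ)^(-(1/2) : ℝ) * gww x n : ℝ) : ℂ)‖ ≤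
      29/4 * (Real.log (p / Real.pi) * (1 + 1/10^6) + 10.251) := by
  have hc : Continuous fun ε : ℝ => ‖∑ n ∈ Finset.Ioc 0 ⌊x⌋₊, gwc p χ ε n * (gww x n : ℂ)‖ := by
    refine (continuous_finsetSum _ fun n hn => ?_).norm
    have hn0 : (n:ℝ) ≠ 0 := by
      have := (Finset.mem_Ioc.mp hn).1
      positivity
    unfold gwc
    have : Continuous fun ε : ℝ => (n:ℝ)^(-(1/2+ε)) := by
      exact Continuous.rpow continuous_const (by fun_prop) (fun _ => Or.inl hn0)
    fun_prop
  have h0 : ‖∑ n ∈ Finset.Ioc 0 ⌊x⌋₊, gwc p χ 0 n * (gww x n : ℂ)‖ ≤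
      29/4 * (Real.log (p / Real.pi) * (1 + 1/10^6) + 10.251) := by
    refine le_of_tendsto ((hc.tendsto 0).mono_left nhdsWithin_le_nhds : Tendsto _ (𝓝[>] (0:ℝ)) _) ?_
    have : ∀ᶠ e : ℝ in 𝓝[>] (0:ℝ), e < 1/10 := nhdsWithin_le_nhds (eventually_lt_nhds (by norm_num))
    filter_upwards [this, self_mem_nhdsWithin] with e h1 h2
    exact gw_F2_eps p hp4 χ hχ hG e h2 h1.le x hx
  refine le_trans (le_of_eq ?_) h0
  congr 1
  apply Finset.sum_congr rfl
  intro n _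
  unfold gwc
  push_cast
  rw [add_zero]; ring

end

section
open Real

theorem gw_T (K N : ℕ) (h : N ≤ K) :
    ∑ n ∈ Finset.Ioc 0 K, ArithmeticFunction.vonMangoldt n * ((N / n : ℕ) : ℝ) = Real.log (N.factorial) := by
  induction N with
  | zero => simp
  | succ N ih =>
    have ih := ih (by omega)
    rw [Nat.factorial_succ, Nat.cast_mul, Real.log_mul (by positivity) (by positivity), ← ih,
      ← ArithmeticFunction.vonMangoldt_sum]
    have : ∑ i ∈ (N+1).divisors, ArithmeticFunction.vonMangoldt i =
        ∑ n ∈ Finset.Ioc 0 K, ArithmeticFunction.vonMangoldt n * (if n ∣ N+1 then 1 else 0) := by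
      simp_rw [mul_ite, mul_one, mul_zero]
      rw [← Finset.sum_filter]
      apply Finset.sum_congr _ fun _ _ => rfl
      ext n
      simp only [Nat.mem_divisors, Finset.mem_filter, Finset.mem_Ioc]
      constructor
      · rintro ⟨h1, h2⟩
        exact ⟨⟨Nat.pos_of_dvd_of_pos h1 (by omega), (Nat.le_of_dvd (by omega) h1).trans h⟩, h1⟩
      · rintro ⟨_, h2⟩
        exact ⟨h2, by omega⟩
    rw [this, ← Finset.sum_add_distrib]
    apply Finset.sum_congr rfl
    intro n _
    rw [Nat.succ_div]
    split_ifs <;> push_cast <;> ring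

theorem gw_coef (m n : ℕ) : 30*m/n + m/n ≤ 1 + 15*m/n + 10*m/n + 6*m/n := by
  have h2 : 15*m/n = 30*m/n/2 := by
    rw [Nat.div_div_eq_div_mul, mul_comm n 2, show 30*m = 2*(15*m) by ring, Nat.mul_div_mul_left _ _ (by norm_num)]
  have h3 : 10*m/n = 30*m/n/3 := by
    rw [Nat.div_div_eq_div_mul, mul_comm n 3, show 30*m = 3*(10*m) by ring, Nat.mul_div_mul_left _ _ (by norm_num)]
  have h5 : 6*m/n = 30*m/n/5 := by
    rw [Nat.div_div_eq_div_mul, mul_comm n 5, show 30*m = 5*(6*m) by ring, Nat.mul_div_mul_left _ _ (by norm_num)]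
  have h30 : m/n = 30*m/n/30 := by
    rw [Nat.div_div_eq_div_mul, mul_comm n 30, Nat.mul_div_mul_left _ _ (by norm_num)]
  rw [h2, h3, h5, h30]
  generalize 30*m/n = k
  omega

theorem gw_fact_le (n : ℕ) : Real.log ((n+1).factorial) ≤ (n+1) * Real.log (n+1) - (n+1) + Real.log (n+1) + 1 := by
  induction n with
  | zero => simp
  | succ n ih =>
    rw [Nat.factorial_succ, Nat.cast_mul, Real.log_mul (by positivity) (by positivity)]
    have h : 1 ≤ (n+2:ℝ) * (Real.log (n+2) - Real.log (n+1)) := by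
      rw [← Real.log_div (by positivity) (by positivity)]
      have h1 := Real.one_sub_inv_le_log_of_pos (x := ((n:ℝ)+2)/(n+1)) (by positivity)
      have h2 : 1 - (((n:ℝ)+2)/(n+1))⁻¹ = 1/(n+2) := by field_simp; ring
      rw [h2] at h1
      calc 1 = (n+2:ℝ) * (1/(n+2)) := by field_simp
        _ ≤ _ := by gcongr
    push_cast
    rw [show (n:ℝ)+1+1 = n+2 by ring]
    nlinarith

theorem gw_fact_ge (n : ℕ) (hn : 0 < n) : n * Real.log n - n ≤ Real.log (n.factorial) := by
  have h := Stirling.le_log_factorial_stirling hn.ne'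
  have : 0 ≤ Real.log n := Real.log_natCast_nonneg n
  have : 0 ≤ Real.log (2 * π) := Real.log_nonneg (by linarith [Real.pi_gt_three])
  linarith

theorem gw_fact_le' (n : ℕ) (hn : 0 < n) : Real.log (n.factorial) ≤ n * Real.log n - n + Real.log n + 1 := by
  obtain ⟨k, rfl⟩ : ∃ k, n = k+1 := ⟨n-1, by omega⟩
  have := gw_fact_le k
  push_cast
  exact this

theorem gw_psi_30 (m : ℕ) (hm : 0 < m) : 27.6267 * m - 3 * Real.log (15*m) - 3 ≤ Chebyshev.psi ((30*m : ℕ) : ℝ) := by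
  have h : Real.log ((30*m).factorial) - Real.log ((15*m).factorial) - Real.log ((10*m).factorial)
      - Real.log ((6*m).factorial) + Real.log (m.factorial) ≤ Chebyshev.psi ((30*m : ℕ) : ℝ) := by
    rw [← gw_T (30*m) (30*m) le_rfl, ← gw_T (30*m) (15*m) (by omega), ← gw_T (30*m) (10*m) (by omega),
      ← gw_T (30*m) (6*m) (by omega), ← gw_T (30*m) m (by omega)]
    unfold Chebyshev.psi
    rw [Nat.floor_natCast, ← Finset.sum_sub_distrib, ← Finset.sum_sub_distrib, ← Finset.sum_sub_distrib, ← Finset.sum_add_distrib]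
    apply Finset.sum_le_sum
    intro n _
    have h1 : ((30*m/n : ℕ):ℝ) + (m/n:ℕ) ≤ 1 + (15*m/n:ℕ) + (10*m/n:ℕ) + (6*m/n:ℕ) := by exact_mod_cast gw_coef m n
    have h2 : 0 ≤ ArithmeticFunction.vonMangoldt n := ArithmeticFunction.vonMangoldt_nonneg
    nlinarith
  have h30 := gw_fact_ge (30*m) (by omega)
  have h1 := gw_fact_ge m hm
  have h15 := gw_fact_le' (15*m) (by omega)
  have h10 := gw_fact_le' (10*m) (by omega)
  have h6 := gw_fact_le' (6*m) (by omega)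
  have hm0 : (0:ℝ) < m := by exact_mod_cast hm
  push_cast at h30 h15 h10 h6
  have e2 : Real.log (10*m) ≤ Real.log (15*m) := Real.log_le_log (by positivity) (by linarith)
  have e3 : Real.log (6*m) ≤ Real.log (15*m) := Real.log_le_log (by positivity) (by linarith)
  have hX : 27.6267 ≤ 30 * Real.log 30 - 15 * Real.log 15 - 10 * Real.log 10 - 6 * Real.log 6 := by
    have l30 : Real.log 30 = Real.log 2 + Real.log 3 + Real.log 5 := by
      rw [← Real.log_mul (by norm_num) (by norm_num), ← Real.log_mul (by norm_num) (by norm_num)]; norm_num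
    have l15 : Real.log 15 = Real.log 3 + Real.log 5 := by
      rw [← Real.log_mul (by norm_num) (by norm_num)]; norm_num
    have l10 : Real.log 10 = Real.log 2 + Real.log 5 := by
      rw [← Real.log_mul (by norm_num) (by norm_num)]; norm_num
    have l6 : Real.log 6 = Real.log 2 + Real.log 3 := by
      rw [← Real.log_mul (by norm_num) (by norm_num)]; norm_num
    have hh : Real.log ((2^93)^3) ≤ Real.log ((2^14*3^9*5^5)^7) := Real.log_le_log (by norm_num) (by norm_num)
    rw [Real.log_pow, Real.log_pow, Real.log_pow, Real.log_mul (by norm_num) (by norm_num), Real.log_mul (by norm_num) (by norm_num),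
      Real.log_pow, Real.log_pow, Real.log_pow] at hh
    push_cast at hh
    have := Real.log_two_gt_d9
    rw [l30, l15, l10, l6]
    linarith
  have s30 : Real.log (30*m) = Real.log 30 + Real.log m := Real.log_mul (by norm_num) hm0.ne'
  have s15 : Real.log (15*m) = Real.log 15 + Real.log m := Real.log_mul (by norm_num) hm0.ne'
  have s10 : Real.log (10*m) = Real.log 10 + Real.log m := Real.log_mul (by norm_num) hm0.ne'
  have s6 : Real.log (6*m) = Real.log 6 + Real.log m := Real.log_mul (by norm_num) hm0.ne'
  have key : 30 * m * Real.log (30*m) - 15*m*Real.log (15*m) - 10*m*Real.log (10*m) - 6*m*Real.log (6*m) + m * Real.log m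
      = m * (30 * Real.log 30 - 15 * Real.log 15 - 10 * Real.log 10 - 6 * Real.log 6) := by
    rw [s30, s15, s10, s6]; ring
  have := mul_le_mul_of_nonneg_left hX hm0.le
  linarith

theorem gw_psi_ge (t : ℝ) (ht : 10^6 ≤ t) : 0.92 * t ≤ Chebyshev.psi t := by
  set m := ⌊t/30⌋₊ with hm
  have h1 : (m:ℝ) ≤ t/30 := Nat.floor_le (by linarith)
  have h2 : t/30 < m + 1 := Nat.lt_floor_add_one _
  have hm0 : 0 < m := by
    rcases Nat.eq_zero_or_pos m with h | h
    · rw [h] at h2; push_cast at h2; linarith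
    · exact h
  have hm0' : (0:ℝ) < m := by exact_mod_cast hm0
  have h3 := gw_psi_30 m hm0
  have h4 : Chebyshev.psi ((30*m:ℕ):ℝ) ≤ Chebyshev.psi t := Chebyshev.psi_mono (by push_cast; linarith)
  have h5 : Real.log (15*m) ≤ t/10^6 + 17 := by
    have : Real.log (15*m) ≤ Real.log t := Real.log_le_log (by positivity) (by linarith)
    have h6 := Real.log_le_sub_one_of_pos (x := t/10^6) (by linarith)
    rw [Real.log_div (by linarith) (by norm_num)] at h6
    have h7 : Real.log (10^6) ≤ Real.log (2^24) := Real.log_le_log (by norm_num) (by norm_num)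
    rw [Real.log_pow (2:ℝ) 24] at h7
    have := Real.log_two_lt_d9
    push_cast at h7
    generalize Real.log ((10:ℝ)^6) = a at h6 h7
    linarith
  linarith

end

section
open MeasureTheory

theorem gw_abel_ge (a b : ℝ) (ha : 1 ≤ a) (hab : a ≤ b) (f f' H H' : ℝ → ℝ)
    (hf : ∀ t ∈ Set.Icc a b, HasDerivAt f (f' t) t) (hc : ContinuousOn f' (Set.Icc a b))
    (hH : ∀ t ∈ Set.Icc a b, HasDerivAt H (H' t) t) (hHc : ContinuousOn H' (Set.Icc a b))
    (hle : ∀ t ∈ Set.Icc a b, H' t ≤ -(f' t * Chebyshev.psi t)) :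
    f b * Chebyshev.psi b - f a * Chebyshev.psi a + (H b - H a) ≤
      ∑ k ∈ Finset.Ioc ⌊a⌋₊ ⌊b⌋₊, f k * ArithmeticFunction.vonMangoldt k := by
  have hd : Set.EqOn (deriv f) f' (Set.Icc a b) := fun t ht => (hf t ht).deriv
  have hi : IntegrableOn (deriv f) (Set.Icc a b) :=
    (hc.integrableOn_Icc).congr_fun hd.symm measurableSet_Icc
  have h1 := sum_mul_eq_sub_sub_integral_mul (fun n => ArithmeticFunction.vonMangoldt n) (by linarith : 0 ≤ a) hab
    (fun t ht => (hf t ht).differentiableAt) hi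
  rw [h1]
  have h2 := integrableOn_mul_sum_Icc (fun n => ArithmeticFunction.vonMangoldt n) (m := 0) (by linarith : 0 ≤ a) hi
  simp_rw [← Chebyshev.psi_eq_sum_Icc] at h2 ⊢
  have h3 : H b - H a = ∫ t in Set.Ioc a b, H' t := by
    rw [← intervalIntegral.integral_of_le hab]
    symm
    apply intervalIntegral.integral_eq_sub_of_hasDerivAt
    · rw [Set.uIcc_of_le hab]; exact hH
    · apply ContinuousOn.intervalIntegrable
      rw [Set.uIcc_of_le hab]; exact hHc
  have h4 : ∫ t in Set.Ioc a b, H' t ≤ ∫ t in Set.Ioc a b, -(deriv f t * Chebyshev.psi t) := by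
    apply setIntegral_mono_on
    · exact (hHc.integrableOn_Icc).mono_set Set.Ioc_subset_Icc_self
    · exact (h2.mono_set Set.Ioc_subset_Icc_self).neg
    · exact measurableSet_Ioc
    · intro t ht
      have ht' := Set.Ioc_subset_Icc_self ht
      rw [hd ht']
      exact hle t ht'
  rw [integral_neg] at h4
  linarith

theorem gw_rp (s : ℝ) (hs : 0 < s) : (s^2)^(1/2:ℝ) = s ∧ (s^2)^(3/2:ℝ) = s^3 ∧ (s^2)^(-(1/2):ℝ) = s⁻¹ ∧ (s^2)^(-(3/2):ℝ) = (s^3)⁻¹ := by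
  have h1 : (s^2)^(1/2:ℝ) = s := by
    rw [← Real.rpow_natCast, ← Real.rpow_mul hs.le]; norm_num
  have h2 : (s^2)^(3/2:ℝ) = s^3 := by
    rw [← Real.rpow_natCast, ← Real.rpow_mul hs.le, ← Real.rpow_natCast]; norm_num
  refine ⟨h1, h2, ?_, ?_⟩
  · rw [Real.rpow_neg (by positivity), h1]
  · rw [Real.rpow_neg (by positivity), h2]

theorem gw_part1 (s : ℝ) (hs : 2500 ≤ s) :
    (609/16/s^2) * (2*s/5) * Chebyshev.psi ((2*s/5)^2) - (609/16/s^2) * (Real.log 4 * (2*s/5)^3 / 3 + Real.log (s^2) * (2*s/5)^2) ≤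
    ∑ k ∈ Finset.Ioc 0 ⌊(2*s/5)^2⌋₊, ArithmeticFunction.vonMangoldt k * (k:ℝ)^(-(1/2):ℝ) * gww (s^2) k := by
  set K : ℝ := 609/16/s^2 with hK
  set y : ℝ := (2*s/5)^2 with hy
  set L : ℝ := Real.log (s^2) with hL
  have hK0 : 0 < K := by positivity
  have hL0 : 0 ≤ L := Real.log_nonneg (by nlinarith)
  have hy1 : 1 ≤ y := by rw [hy]; nlinarith
  have h := gw_abel_ge 1 y le_rfl hy1 (fun t => K * t^(1/2:ℝ)) (fun t => K * ((1/2) * t^(1/2-1:ℝ)))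
    (fun t => -(K * (Real.log 4 / 3 * t^(3/2:ℝ) + L * t)))
    (fun t => -(K * (Real.log 4 / 3 * (3/2 * t^(3/2-1:ℝ)) + L * 1)))
    (fun t ht => (Real.hasDerivAt_rpow_const (Or.inl (by linarith [ht.1]))).const_mul K)
    (by
      refine continuousOn_const.mul (continuousOn_const.mul ?_)
      exact ContinuousOn.rpow_const continuousOn_id (fun t ht => Or.inl (by have h9 := ht.1; intro h8; rw [h8] at h9; linarith)))
    (fun t ht => ((((Real.hasDerivAt_rpow_const (Or.inl (by linarith [ht.1]))).const_mul _).add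
      ((hasDerivAt_id t).const_mul L)).const_mul K).neg)
    (by
      refine (continuousOn_const.mul ((continuousOn_const.mul (continuousOn_const.mul ?_)).add continuousOn_const)).neg
      exact ContinuousOn.rpow_const continuousOn_id (fun t ht => Or.inl (by have h9 := ht.1; intro h8; rw [h8] at h9; linarith)))
    (by
      intro t ht
      have ht0 : 0 < t := by linarith [ht.1]
      have h1 := Chebyshev.psi_le ht.1
      have h2 : Real.log t ≤ L := Real.log_le_log ht0 (by have := ht.2; rw [hy] at this; nlinarith)
      obtain ⟨q, hq, rfl⟩ : ∃ q : ℝ, 0 < q ∧ t = q^2 := ⟨√t, by positivity, (Real.sq_sqrt ht0.le).symm⟩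
      rw [Real.sqrt_sq hq.le] at h1
      have e1 : (q^2)^(1/2-1:ℝ) = q⁻¹ := by rw [show (1/2-1:ℝ) = -(1/2) by norm_num]; exact (gw_rp q hq).2.2.1
      have e2 : (q^2)^(3/2-1:ℝ) = q := by rw [show (3/2-1:ℝ) = (1/2) by norm_num]; exact (gw_rp q hq).1
      rw [e1, e2]
      have h3 : Chebyshev.psi (q^2) ≤ Real.log 4 * q^2 + 2 * q * L := h1.trans (by gcongr)
      have h4 : K * (1/2 * q⁻¹) * Chebyshev.psi (q^2) ≤ K * (1/2 * q⁻¹) * (Real.log 4 * q^2 + 2 * q * L) := by gcongr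
      have h5 : K * (1/2 * q⁻¹) * (Real.log 4 * q^2 + 2 * q * L) = K * (Real.log 4 / 3 * (3/2 * q) + L * 1) := by
        field_simp
      linarith)
  have hs1 : 0 < 2*s/5 := by linarith
  have r := gw_rp (2*s/5) hs1
  simp only [hy, r.1, r.2.1, Real.one_rpow, Chebyshev.psi_one, Nat.floor_one] at h
  rw [← hy] at h
  have hfl : 1 ≤ ⌊y⌋₊ := (Nat.one_le_floor_iff _).mpr hy1
  have hsum : ∑ k ∈ Finset.Ioc 0 ⌊y⌋₊, ArithmeticFunction.vonMangoldt k * (k:ℝ)^(-(1/2):ℝ) * gww (s^2) k =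
     ∑ k ∈ Finset.Ioc 1 ⌊y⌋₊, K * (k:ℝ)^(1/2:ℝ) * ArithmeticFunction.vonMangoldt k := by
    rw [← Finset.sum_Ioc_consecutive _ (Nat.zero_le 1) hfl]
    have : ∑ k ∈ Finset.Ioc 0 1, ArithmeticFunction.vonMangoldt k * (k:ℝ)^(-(1/2):ℝ) * gww (s^2) k = 0 := by simp
    rw [this, zero_add]
    apply Finset.sum_congr rfl
    intro k hk
    rw [Finset.mem_Ioc] at hk
    have hk0 : (0:ℝ) < k := by exact_mod_cast (by omega : 0 < k)
    rw [gww_one (s^2) k (by omega) ?_]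
    · have : (k:ℝ)^(1/2:ℝ) = (k:ℝ)^(-(1/2):ℝ) * k := by
        nth_rewrite 3 [← Real.rpow_one (k:ℝ)]
        rw [← Real.rpow_add hk0]; norm_num
      rw [this, hK]; field_simp
    · have h1 : (k:ℝ) ≤ y := (Nat.le_floor_iff (by linarith)).mp hk.2
      rw [hy] at h1
      linarith
  rw [hsum]
  refine le_trans ?_ h
  have hl4 : 0 ≤ Real.log 4 := Real.log_nonneg (by norm_num)
  have : 0 ≤ K * (Real.log 4 / 3 * 1 + L * 1) := by positivity
  linarith

theorem gw_part2 (s : ℝ) (hs : 2500 ≤ s) :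
    - ((609/16/s^2) * (2*s/5) * Chebyshev.psi ((2*s/5)^2)) + 0.92 * 4.812 * s ≤
    ∑ k ∈ Finset.Ioc ⌊(2*s/5)^2⌋₊ ⌊s^2⌋₊, ArithmeticFunction.vonMangoldt k * (k:ℝ)^(-(1/2):ℝ) * gww (s^2) k := by
  set y : ℝ := (2*s/5)^2 with hy
  have hs0 : 0 < s := by linarith
  have hy1 : 10^6 ≤ y := by rw [hy]; nlinarith
  have hyx : y ≤ s^2 := by rw [hy]; nlinarith
  have h := gw_abel_ge y (s^2) (by linarith) hyx (fun t => s^2 * t^(-(3/2):ℝ) - (s^2)⁻¹ * t^(1/2:ℝ))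
    (fun t => s^2 * (-(3/2) * t^(-(3/2)-1:ℝ)) - (s^2)⁻¹ * ((1/2) * t^(1/2-1:ℝ)))
    (fun t => 0.92 * (-3 * s^2 * t^(-(1/2):ℝ) + ((s^2)⁻¹/3) * t^(3/2:ℝ)))
    (fun t => 0.92 * (-3 * s^2 * (-(1/2) * t^(-(1/2)-1:ℝ)) + ((s^2)⁻¹/3) * ((3/2) * t^(3/2-1:ℝ))))
    (fun t ht => ((Real.hasDerivAt_rpow_const (Or.inl (by linarith [ht.1]))).const_mul _).sub
      ((Real.hasDerivAt_rpow_const (Or.inl (by linarith [ht.1]))).const_mul _))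
    (by
      refine (continuousOn_const.mul (continuousOn_const.mul ?_)).sub (continuousOn_const.mul (continuousOn_const.mul ?_)) <;>
      exact ContinuousOn.rpow_const continuousOn_id (fun t ht => Or.inl (by have h9 := ht.1; intro h8; rw [h8] at h9; linarith)))
    (fun t ht => (((Real.hasDerivAt_rpow_const (Or.inl (by linarith [ht.1]))).const_mul _).add
      ((Real.hasDerivAt_rpow_const (Or.inl (by linarith [ht.1]))).const_mul _)).const_mul _)
    (by
      refine continuousOn_const.mul ((continuousOn_const.mul (continuousOn_const.mul ?_)).add (continuousOn_const.mul (continuousOn_const.mul ?_))) <;>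
      exact ContinuousOn.rpow_const continuousOn_id (fun t ht => Or.inl (by have h9 := ht.1; intro h8; rw [h8] at h9; linarith)))
    (by
      intro t ht
      have ht0 : 0 < t := by linarith [ht.1]
      have h1 := gw_psi_ge t (by linarith [ht.1])
      obtain ⟨q, hq, rfl⟩ : ∃ q : ℝ, 0 < q ∧ t = q^2 := ⟨√t, by positivity, (Real.sq_sqrt ht0.le).symm⟩
      have r := gw_rp q hq
      have e1 : (q^2)^(1/2-1:ℝ) = q⁻¹ := by rw [show (1/2-1:ℝ) = -(1/2) by norm_num]; exact r.2.2.1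
      have e2 : (q^2)^(3/2-1:ℝ) = q := by rw [show (3/2-1:ℝ) = (1/2) by norm_num]; exact r.1
      have e3 : (q^2)^(-(1/2)-1:ℝ) = (q^3)⁻¹ := by rw [show (-(1/2)-1:ℝ) = -(3/2) by norm_num]; exact r.2.2.2
      have e4 : (q^2)^(-(3/2)-1:ℝ) = (q^5)⁻¹ := by
        rw [Real.rpow_sub (by positivity), Real.rpow_one, r.2.2.2]; field_simp
      rw [e1, e2, e3, e4]
      have h4 : (s^2 * (3/2 * (q^5)⁻¹) + (s^2)⁻¹ * (1/2 * q⁻¹)) * (0.92 * q^2) ≤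
        (s^2 * (3/2 * (q^5)⁻¹) + (s^2)⁻¹ * (1/2 * q⁻¹)) * Chebyshev.psi (q^2) := by gcongr
      have h5 : (s^2 * (3/2 * (q^5)⁻¹) + (s^2)⁻¹ * (1/2 * q⁻¹)) * (0.92 * q^2) =
         0.92 * (-3 * s ^ 2 * (-(1 / 2) * (q ^ 3)⁻¹) + (s ^ 2)⁻¹ / 3 * (3 / 2 * q)) := by
        field_simp
      linarith)
  have hs1 : 0 < 2*s/5 := by linarith
  have r := gw_rp (2*s/5) hs1
  have r2 := gw_rp s hs0
  simp only [hy, r.1, r.2.1, r.2.2.1, r.2.2.2, r2.1, r2.2.1, r2.2.2.1, r2.2.2.2] at h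
  rw [← hy] at h
  have hsum : ∑ k ∈ Finset.Ioc ⌊y⌋₊ ⌊s^2⌋₊, ArithmeticFunction.vonMangoldt k * (k:ℝ)^(-(1/2):ℝ) * gww (s^2) k =
     ∑ k ∈ Finset.Ioc ⌊y⌋₊ ⌊s^2⌋₊, (s^2 * (k:ℝ)^(-(3/2):ℝ) - (s^2)⁻¹ * (k:ℝ)^(1/2:ℝ)) * ArithmeticFunction.vonMangoldt k := by
    apply Finset.sum_congr rfl
    intro k hk
    rw [Finset.mem_Ioc] at hk
    have hky : y < k := Nat.lt_of_floor_lt hk.1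
    have hk0 : (0:ℝ) < k := by linarith
    have hkx : (k:ℝ) ≤ s^2 := (Nat.le_floor_iff (by positivity)).mp hk.2
    rw [gww_two (s^2) k (by exact_mod_cast hk0) (by rw [hy] at hky; linarith) hkx]
    have e1 : (k:ℝ)^(1/2:ℝ) = (k:ℝ)^(-(1/2):ℝ) * k := by
        nth_rewrite 3 [← Real.rpow_one (k:ℝ)]
        rw [← Real.rpow_add hk0]; norm_num
    have e2 : (k:ℝ)^(-(3/2):ℝ) = (k:ℝ)^(-(1/2):ℝ) / k := by
        rw [show (-(3/2):ℝ) = -(1/2) - 1 by norm_num, Real.rpow_sub hk0, Real.rpow_one]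
    rw [e1, e2]; field_simp
  rw [hsum]
  refine le_trans (le_of_eq ?_) h
  field_simp
  ring

theorem gw_main (x : ℝ) (hx : 10^7 ≤ x) : 3.3 * √x - 6.1 * Real.log x ≤
    ∑ k ∈ Finset.Ioc 0 ⌊x⌋₊, ArithmeticFunction.vonMangoldt k * (k:ℝ)^(-(1/2):ℝ) * gww x k := by
  obtain ⟨s, hs, rfl⟩ : ∃ s : ℝ, 0 < s ∧ x = s^2 := ⟨√x, Real.sqrt_pos.mpr (by linarith), (Real.sq_sqrt (by linarith)).symm⟩
  have hs2 : 2500 ≤ s := by nlinarith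
  rw [Real.sqrt_sq hs.le]
  have h1 := gw_part1 s hs2
  have h2 := gw_part2 s hs2
  rw [← Finset.sum_Ioc_consecutive _ (Nat.zero_le _) (Nat.floor_le_floor (by nlinarith : (2*s/5)^2 ≤ s^2))]
  have hl : Real.log 4 ≤ 1.3863 := by
    rw [show (4:ℝ) = 2^2 by norm_num, Real.log_pow]; push_cast; linarith [Real.log_two_lt_d9]
  have hL0 : 0 ≤ Real.log (s^2) := Real.log_nonneg (by nlinarith)
  have e : (609/16/s^2) * (Real.log 4 * (2*s/5)^3 / 3 + Real.log (s^2) * (2*s/5)^2) = 0.812 * Real.log 4 * s + 6.09 * Real.log (s^2) := by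
    field_simp; ring
  have := mul_le_mul_of_nonneg_right hl hs.le
  rw [e] at h1
  linarith

end

section
noncomputable def gwF (p : ℕ) (ψ : ℕ → DirichletCharacter ℂ p) (S : Finset ℕ) (a : ℕ → ℝ) (T : Finset ℕ)
    (χ : DirichletCharacter ℂ p) : ℂ :=
  ∑ n ∈ S, (a n : ℂ) * χ n * ∏ q ∈ T, (1 - (1/(q:ℂ)) * ∑ j ∈ Finset.range q, (ψ q ^ j) n)

theorem gwF_insert (p : ℕ) (ψ : ℕ → DirichletCharacter ℂ p) (S : Finset ℕ) (a : ℕ → ℝ) (T : Finset ℕ)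
    (r : ℕ) (hr : r ∉ T) (hr0 : 0 < r) (χ : DirichletCharacter ℂ p) :
    gwF p ψ S a (insert r T) χ = (1 - 1/(r:ℂ)) * gwF p ψ S a T χ -
      (1/(r:ℂ)) * ∑ j ∈ Finset.Ico 1 r, gwF p ψ S a T (χ * ψ r ^ j) := by
  have h1 : gwF p ψ S a (insert r T) χ = gwF p ψ S a T χ - (1/(r:ℂ)) * ∑ j ∈ Finset.range r, gwF p ψ S a T (χ * ψ r ^ j) := by
    unfold gwF
    rw [Finset.sum_comm, Finset.mul_sum, ← Finset.sum_sub_distrib]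
    apply Finset.sum_congr rfl
    intro n _
    rw [Finset.prod_insert hr]
    simp_rw [MulChar.mul_apply]
    set P := ∏ q ∈ T, (1 - (1/(q:ℂ)) * ∑ j ∈ Finset.range q, (ψ q ^ j) n)
    have : ∑ j ∈ Finset.range r, (a n : ℂ) * (χ n * (ψ r ^ j) n) * P = (a n : ℂ) * χ n * P * ∑ j ∈ Finset.range r, (ψ r ^ j) n := by
      rw [Finset.mul_sum]
      apply Finset.sum_congr rfl
      intro j _
      ring
    rw [this]; ring
  rw [h1, Finset.range_eq_Ico, Finset.sum_eq_sum_Ico_succ_bot hr0]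
  simp
  ring

theorem gwF_bound (p : ℕ) (ψ : ℕ → DirichletCharacter ℂ p) (S : Finset ℕ) (a : ℕ → ℝ) (B : ℝ)
    (hB : ∀ χ : DirichletCharacter ℂ p, χ ≠ 1 → ‖∑ n ∈ S, (a n : ℂ) * χ n‖ ≤ B) (T : Finset ℕ) :
    (∀ q ∈ T, q.Prime ∧ orderOf (ψ q) = q) →
    ∀ (m : ℕ) (_ : ∀ q ∈ T, m.Coprime q) (χ : DirichletCharacter ℂ p) (_ : χ ^ m = 1),
    (χ ≠ 1 → ‖gwF p ψ S a T χ‖ ≤ (∏ q ∈ T, (1 - 1/(q:ℝ))) * (2^T.card * B)) ∧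
    (χ = 1 → ‖gwF p ψ S a T χ - ((∏ q ∈ T, (1 - 1/(q:ℝ)) : ℝ) : ℂ) * ∑ n ∈ S, (a n : ℂ) * χ n‖ ≤
      (∏ q ∈ T, (1 - 1/(q:ℝ))) * ((2^T.card - 1) * B)) := by
  induction T using Finset.induction_on with
  | empty =>
    intro _ m _ χ _
    constructor
    · intro h
      simpa [gwF] using hB χ h
    · intro h
      simp [gwF]
  | insert r T hr ih =>
    intro hT m hm χ hχ
    have ih := ih (fun q hq => hT q (Finset.mem_insert_of_mem hq))
    obtain ⟨hrp, hro⟩ := hT r (Finset.mem_insert_self r T)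
    have hr0 : (0:ℝ) < r := by exact_mod_cast hrp.pos
    have hmr := hm r (Finset.mem_insert_self r T)
    rw [gwF_insert p ψ S a T r hr hrp.pos, Finset.prod_insert hr, Finset.card_insert_of_notMem hr]
    have ih1 := ih m (fun q hq => hm q (Finset.mem_insert_of_mem hq)) χ hχ
    set c := ∏ q ∈ T, (1 - 1/(q:ℝ)) with hc
    have h2 : ∀ j ∈ Finset.Ico 1 r, ‖gwF p ψ S a T (χ * ψ r ^ j)‖ ≤ c * (2^T.card * B) := by
      intro j hj
      rw [Finset.mem_Ico] at hj
      refine (ih (m*r) ?_ (χ * ψ r ^ j) ?_).1 ?_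
      · intro q hq
        apply Nat.Coprime.mul_left (hm q (Finset.mem_insert_of_mem hq))
        rw [Nat.coprime_primes hrp (hT q (Finset.mem_insert_of_mem hq)).1]
        rintro rfl
        exact hr hq
      · have : ψ r ^ r = 1 := by
          have h0 := pow_orderOf_eq_one (ψ r)
          rwa [hro] at h0
        rw [mul_pow, pow_mul, hχ, one_pow, one_mul, ← pow_mul, show j * (m*r) = r * (j*m) by ring, pow_mul, this, one_pow]
      · intro h
        have h3 : (χ * ψ r ^ j)^m = 1 := by rw [h, one_pow]
        rw [mul_pow, hχ, one_mul, ← pow_mul] at h3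
        have h4 := orderOf_dvd_of_pow_eq_one h3
        rw [hro] at h4
        have h5 := hmr.symm.dvd_of_dvd_mul_right h4
        have := Nat.le_of_dvd (by omega) h5
        omega
    have h3 : ‖(1/(r:ℂ)) * ∑ j ∈ Finset.Ico 1 r, gwF p ψ S a T (χ * ψ r ^ j)‖ ≤ (1 - 1/(r:ℝ)) * (c * (2^T.card * B)) := by
      rw [norm_mul]
      have : ‖(1/(r:ℂ))‖ = 1/(r:ℝ) := by simp
      rw [this]
      have h4 := norm_sum_le_of_le _ h2
      rw [Finset.sum_const, Nat.card_Ico, nsmul_eq_mul, Nat.cast_sub hrp.one_le] at h4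
      calc _ ≤ 1/(r:ℝ) * (((r:ℝ) - (1:ℕ)) * (c * (2^T.card * B))) := by gcongr
        _ = _ := by field_simp; push_cast; ring
    have hr1 : 0 ≤ 1 - 1/(r:ℝ) := by
      rw [sub_nonneg, div_le_one hr0]; exact_mod_cast hrp.one_le
    have h5 : ‖(1 - 1/(r:ℂ))‖ = 1 - 1/(r:ℝ) := by
      rw [show (1 - 1/(r:ℂ)) = ((1 - 1/(r:ℝ) : ℝ) : ℂ) by push_cast; ring, Complex.norm_real, Real.norm_of_nonneg hr1]
    constructor
    · intro h
      refine (norm_sub_le _ _).trans ?_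
      rw [norm_mul, h5]
      have := mul_le_mul_of_nonneg_left (ih1.1 h) hr1
      rw [pow_succ]
      linarith
    · intro h
      have e : (1 - 1/(r:ℂ)) * gwF p ψ S a T χ - (1/(r:ℂ)) * ∑ j ∈ Finset.Ico 1 r, gwF p ψ S a T (χ * ψ r ^ j) -
          (((1 - 1/(r:ℝ)) * c : ℝ) : ℂ) * ∑ n ∈ S, (a n : ℂ) * χ n =
          (1 - 1/(r:ℂ)) * (gwF p ψ S a T χ - (c:ℂ) * ∑ n ∈ S, (a n : ℂ) * χ n) -
            (1/(r:ℂ)) * ∑ j ∈ Finset.Ico 1 r, gwF p ψ S a T (χ * ψ r ^ j) := by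
        push_cast; ring
      rw [e]
      refine (norm_sub_le _ _).trans ?_
      rw [norm_mul, h5]
      have := mul_le_mul_of_nonneg_left (ih1.2 h) hr1
      rw [pow_succ]
      linarith

theorem gw_prod_ge (T : Finset ℕ) : (∀ q ∈ T, 2 ≤ q) → 1/((T.card:ℝ)+1) ≤ ∏ q ∈ T, (1 - 1/(q:ℝ)) := by
  induction T using Finset.induction_on_max with
  | empty => simp
  | insert r T hmax ih =>
    intro h
    have hr : r ∉ T := fun hh => lt_irrefl _ (hmax r hh)
    have ih := ih (fun q hq => h q (Finset.mem_insert_of_mem hq))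
    have hr2 := h r (Finset.mem_insert_self _ _)
    rw [Finset.prod_insert hr, Finset.card_insert_of_notMem hr]
    have hcard : T.card + 2 ≤ r := by
      have : T ⊆ Finset.Ico 2 r := fun q hq => Finset.mem_Ico.mpr ⟨h q (Finset.mem_insert_of_mem hq), hmax q hq⟩
      have := Finset.card_le_card this
      rw [Nat.card_Ico] at this
      omega
    have hc : (T.card:ℝ) + 2 ≤ r := by exact_mod_cast hcard
    push_cast
    have h1 : 1 / (r:ℝ) ≤ 1/((T.card:ℝ)+2) := one_div_le_one_div_of_le (by positivity) hc
    have h2 : (1 - 1/((T.card:ℝ)+2)) * (1/((T.card:ℝ)+1)) = 1/((T.card:ℝ)+1+1) := by field_simp; ring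
    have h3 : 0 ≤ 1 - 1/((T.card:ℝ)+2) := by
      rw [sub_nonneg, div_le_one (by positivity)]; linarith [(Nat.cast_nonneg T.card : (0:ℝ) ≤ _)]
    rw [← h2]
    have h4 : 0 ≤ 1/((T.card:ℝ)+1) := by positivity
    exact mul_le_mul (by linarith) ih h4 (by linarith)

/-- Value of the factor at a unit. -/
theorem gw_factor (p : ℕ) (ψ : DirichletCharacter ℂ p) (q : ℕ) (hq : 0 < q) (hψ : ψ ^ q = 1) (n : ZMod p) (hn : IsUnit n) :
    (1 - (1/(q:ℂ)) * ∑ j ∈ Finset.range q, (ψ ^ j) n) = if ψ n = 1 then 0 else 1 := by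
  have hpow : ∀ j, (ψ ^ j) n = (ψ n)^j := by
    intro j
    obtain ⟨u, rfl⟩ := hn
    rw [MulChar.pow_apply_coe]
  simp_rw [hpow]
  have hq0 : (q:ℂ) ≠ 0 := by exact_mod_cast hq.ne'
  split_ifs with h
  · rw [h]; simp [hq0]
  · rw [geom_sum_eq h, ← hpow, hψ, MulChar.one_apply hn]; simp

theorem gw_exists_char (p : ℕ) [Fact p.Prime] (q : ℕ) (hq : q ∣ p - 1) :
    ∃ ψ : DirichletCharacter ℂ p, orderOf ψ = q ∧ ∀ n : ZMod p, n ≠ 0 → n ^ ((p-1)/q) = 1 → ψ n = 1 := by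
  have hp : p.Prime := Fact.out
  have hp1 : 0 < p - 1 := by have := hp.two_le; omega
  have : NeZero (p-1) := ⟨hp1.ne'⟩
  obtain ⟨ζ, hζ⟩ : ∃ ζ : ℂ, IsPrimitiveRoot ζ (p-1) := ⟨_, Complex.isPrimitiveRoot_exp (p-1) hp1.ne'⟩
  obtain ⟨χ, hχ⟩ := MulChar.exists_mulChar_orderOf (ZMod p) (n := p-1) (by rw [ZMod.card]) hζ
  refine ⟨χ ^ ((p-1)/q), ?_, ?_⟩
  · rw [orderOf_pow, hχ, Nat.gcd_eq_right (Nat.div_dvd_of_dvd hq), Nat.div_div_self hq hp1.ne']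
  · intro n hn h
    have hu : IsUnit n := isUnit_iff_ne_zero.mpr hn
    obtain ⟨u, rfl⟩ := hu
    rw [MulChar.pow_apply_coe, ← map_pow, h, map_one]

end

section
noncomputable def gwa (x : ℝ) (n : ℕ) : ℝ := ArithmeticFunction.vonMangoldt n * (n:ℝ)^(-(1/2):ℝ) * gww x n

theorem gww_bounds (x : ℝ) (n : ℕ) (hn : 0 < n) (hx : (n:ℝ) ≤ x) :
    0 ≤ gww x n ∧ (n:ℝ)^(-(1/2):ℝ) * gww x n ≤ 15.625 / √x := by
  have hn0 : (0:ℝ) < n := by exact_mod_cast hn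
  have hx0 : 0 < x := by linarith
  obtain ⟨s, hs, rfl⟩ : ∃ s : ℝ, 0 < s ∧ x = s^2 := ⟨√x, Real.sqrt_pos.mpr hx0, (Real.sq_sqrt (by linarith)).symm⟩
  rw [Real.sqrt_sq hs.le]
  obtain ⟨q, hq, hqn⟩ : ∃ q : ℝ, 0 < q ∧ (n:ℝ) = q^2 := ⟨√n, Real.sqrt_pos.mpr hn0, (Real.sq_sqrt hn0.le).symm⟩
  have e : (n:ℝ)^(-(1/2):ℝ) = q⁻¹ := by rw [hqn]; exact (gw_rp q hq).2.2.1
  rw [e]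
  rcases le_total (n:ℝ) (s^2/(25/4)) with h | h
  · rw [gww_one _ n hn h]
    refine ⟨by positivity, ?_⟩
    rw [hqn] at h ⊢
    have h1 : q ≤ 2*s/5 := by
      apply le_of_sq_le_sq _ (by positivity)
      linarith
    have : q⁻¹ * (609/16 * (q^2/s^2)) = 609/16 * q / s^2 := by field_simp
    rw [this, div_le_div_iff₀ (by positivity) hs]
    nlinarith
  · rw [gww_two _ n hn h hx]
    rw [hqn] at h hx ⊢
    have h1 : 2*s/5 ≤ q := by
      apply le_of_sq_le_sq _ hq.le
      linarith
    constructor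
    · have h2 : q^2/s^2 ≤ 1 := by rw [div_le_one (by positivity)]; exact hx
      have h3 : 1 ≤ s^2/q^2 := by rw [one_le_div (by positivity)]; exact hx
      linarith
    · have h2 : 0 ≤ q⁻¹ * (q^2/s^2) := by positivity
      have h3 : q⁻¹ * (s^2/q^2) ≤ 15.625/s := by
        have : q⁻¹ * (s^2/q^2) = s^2/q^3 := by field_simp
        rw [this, div_le_div_iff₀ (by positivity) hs]
        have : (2*s/5)^3 ≤ q^3 := by gcongr
        nlinarith
      rw [mul_sub]; linarith

theorem gw_pp (x : ℝ) (hx : 10^7 ≤ x) : Chebyshev.psi x - Chebyshev.theta x ≤ 6.47 * √x := by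
  have hx0 : 0 < x := by linarith
  have h := Chebyshev.psi_sub_theta_le_psi_add_psi_add_psi x
  have k1 := Chebyshev.psi_le_const_mul_self (x := x ^ (2:ℝ)⁻¹) (by positivity)
  have k2 := Chebyshev.psi_le_const_mul_self (x := x ^ (3:ℝ)⁻¹) (by positivity)
  have k3 := Chebyshev.psi_le_const_mul_self (x := x ^ (5:ℝ)⁻¹) (by positivity)
  have e1 : x ^ (2:ℝ)⁻¹ = √x := by rw [Real.sqrt_eq_rpow]; norm_num
  have hl : Real.log 4 ≤ 1.3863 := by
    rw [show (4:ℝ) = 2^2 by norm_num, Real.log_pow]; push_cast; linarith [Real.log_two_lt_d9]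
  have hl0 : 0 ≤ Real.log 4 := Real.log_nonneg (by norm_num)
  have e2 : x ^ (3:ℝ)⁻¹ ≤ √x / 10 := by
    have : (10:ℝ) ≤ x^(1/6:ℝ) := by
      calc (10:ℝ) = ((10:ℝ)^6)^(1/6:ℝ) := by
            rw [← Real.rpow_natCast, ← Real.rpow_mul (by norm_num)]; norm_num
        _ ≤ _ := Real.rpow_le_rpow (by norm_num) (by linarith) (by norm_num)
    have e : √x = x ^ (3:ℝ)⁻¹ * x^(1/6:ℝ) := by
      rw [Real.sqrt_eq_rpow, ← Real.rpow_add hx0]; norm_num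
    rw [e]
    have : 0 < x ^ (3:ℝ)⁻¹ := by positivity
    nlinarith
  have e3 : x ^ (5:ℝ)⁻¹ ≤ x ^ (3:ℝ)⁻¹ := Real.rpow_le_rpow_of_exponent_le (by linarith) (by norm_num)
  rw [e1] at h k1
  have hs : 0 ≤ √x := Real.sqrt_nonneg x
  have : (Real.log 4 + 4) * (√x + x ^ (3:ℝ)⁻¹ + x ^ (5:ℝ)⁻¹) ≤ (1.3863 + 4) * (√x + √x/10 + √x/10) := by
    gcongr
    linarith
  linarith

theorem gw_combine (p : ℕ) (hp : p.Prime) (hω : (p - 1).primeFactors.card ≤ 6) (x : ℝ) (hx : 10^7 ≤ x) (hxp : x < p)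
    (B : ℝ) (hB0 : 0 ≤ B)
    (hB : ∀ χ : DirichletCharacter ℂ p, χ ≠ 1 → ‖∑ n ∈ Finset.Ioc 0 ⌊x⌋₊, (gwa x n : ℂ) * χ n‖ ≤ B)
    (hno : ∀ q : ℕ, q.Prime → orderOf (q : ZMod p) = p - 1 → x ≤ q) :
    ∑ n ∈ Finset.Ioc 0 ⌊x⌋₊, gwa x n ≤ 7 * (15.625 * 6.47) + 63 * B := by
  have : Fact p.Prime := ⟨hp⟩
  have hx0 : 0 < x := by linarith
  have hp1 : 0 < p - 1 := by have := hp.two_le; omega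
  have hex : ∀ q : ℕ, ∃ ψ : DirichletCharacter ℂ p, q ∣ p - 1 →
    orderOf ψ = q ∧ ∀ n : ZMod p, n ≠ 0 → n ^ ((p-1)/q) = 1 → ψ n = 1 := by
    intro q
    by_cases h : q ∣ p - 1
    · obtain ⟨ψ, hψ⟩ := gw_exists_char p q h
      exact ⟨ψ, fun _ => hψ⟩
    · exact ⟨1, fun h' => absurd h' h⟩
  choose ψ hψ using hex
  set T := (p-1).primeFactors with hT
  set S := Finset.Ioc 0 ⌊x⌋₊ with hS
  have hTm : ∀ q ∈ T, q.Prime ∧ q ∣ p - 1 := fun q hq => ⟨Nat.prime_of_mem_primeFactors hq, Nat.dvd_of_mem_primeFactors hq⟩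
  have hb := (gwF_bound p ψ S (gwa x) B hB T (fun q hq => ⟨(hTm q hq).1, (hψ q (hTm q hq).2).1⟩) 1 (by simp) 1 (by simp)).2 rfl
  have hSm : ∀ n ∈ S, 0 < n ∧ (n:ℝ) ≤ x ∧ (n : ZMod p) ≠ 0 := by
    intro n hn
    rw [hS, Finset.mem_Ioc] at hn
    have h1 : (n:ℝ) ≤ x := (Nat.le_floor_iff hx0.le).mp hn.2
    refine ⟨hn.1, h1, ?_⟩
    rw [Ne, ZMod.natCast_eq_zero_iff]
    intro h
    have h2 := Nat.le_of_dvd hn.1 h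
    have h3 : (p:ℝ) ≤ n := by exact_mod_cast h2
    linarith
  have ha : ∀ n ∈ S, 0 ≤ gwa x n ∧ gwa x n ≤ 15.625/√x * ArithmeticFunction.vonMangoldt n := by
    intro n hn
    obtain ⟨h1, h2, _⟩ := hSm n hn
    have h3 := gww_bounds x n h1 h2
    have h4 : 0 ≤ ArithmeticFunction.vonMangoldt n := ArithmeticFunction.vonMangoldt_nonneg
    unfold gwa
    refine ⟨mul_nonneg (mul_nonneg h4 (by positivity)) h3.1, ?_⟩
    rw [mul_assoc, mul_comm]
    exact mul_le_mul_of_nonneg_right h3.2 h4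
  have hprod : ∀ n ∈ S, ∏ q ∈ T, (1 - (1/(q:ℂ)) * ∑ j ∈ Finset.range q, (ψ q ^ j) n) =
      ∏ q ∈ T, (if ψ q n = 1 then (0:ℂ) else 1) := by
    intro n hn
    apply Finset.prod_congr rfl
    intro q hq
    apply gw_factor p (ψ q) q (hTm q hq).1.pos
    · have h0 := pow_orderOf_eq_one (ψ q)
      rwa [(hψ q (hTm q hq).2).1] at h0
    · exact isUnit_iff_ne_zero.mpr (hSm n hn).2.2
  have hone : ∀ n ∈ S, (1 : DirichletCharacter ℂ p) n = 1 := fun n hn =>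
    MulChar.one_apply (isUnit_iff_ne_zero.mpr (hSm n hn).2.2)
  have hF : ‖gwF p ψ S (gwa x) T 1‖ ≤ 15.625 * 6.47 := by
    have h1 : ‖gwF p ψ S (gwa x) T 1‖ ≤ ∑ n ∈ S, (if ¬ n.Prime then 15.625/√x * ArithmeticFunction.vonMangoldt n else 0) := by
      unfold gwF
      apply norm_sum_le_of_le
      intro n hn
      rw [hprod n hn, hone n hn, mul_one, norm_mul, Complex.norm_real, Real.norm_of_nonneg (ha n hn).1]
      by_cases hpr : ¬ n.Prime
      · rw [if_pos hpr]
        refine le_trans ?_ (ha n hn).2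
        apply mul_le_of_le_one_right (ha n hn).1
        rw [norm_prod]
        apply Finset.prod_le_one
        · intros; positivity
        · intro q _
          split_ifs <;> simp
      · rw [if_neg hpr]
        rw [not_not] at hpr
        apply le_of_eq
        by_cases ho : orderOf (n : ZMod p) = p - 1
        · have h2 := hno n hpr ho
          have : gwa x n = 0 := by unfold gwa; rw [gww_three x n hx0 h2, mul_zero]
          rw [this, zero_mul]
        · have : ∃ q ∈ T, (n : ZMod p)^((p-1)/q) = 1 := by
            by_contra hcon
            push Not at hcon
            apply ho
            apply orderOf_eq_of_pow_and_pow_div_prime hp1 (ZMod.pow_card_sub_one_eq_one (hSm n hn).2.2)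
            intro q hq hqd
            exact hcon q (Nat.mem_primeFactors.mpr ⟨hq, hqd, hp1.ne'⟩)
          obtain ⟨q, hq, hq1⟩ := this
          rw [Finset.prod_eq_zero hq, norm_zero, mul_zero]
          rw [if_pos ((hψ q (hTm q hq).2).2 _ (hSm n hn).2.2 hq1)]
    refine h1.trans ?_
    rw [← Finset.sum_filter, ← Finset.mul_sum]
    have h2 := gw_pp x hx
    rw [Chebyshev.psi_sub_theta_eq_sum_not_prime] at h2
    have hs : 0 < √x := Real.sqrt_pos.mpr hx0
    calc _ ≤ 15.625/√x * (6.47 * √x) := by gcongr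
      _ = _ := by field_simp
  have hsum : ∑ n ∈ S, (gwa x n : ℂ) * (1 : DirichletCharacter ℂ p) n = ((∑ n ∈ S, gwa x n : ℝ) : ℂ) := by
    push_cast
    apply Finset.sum_congr rfl
    intro n hn
    rw [hone n hn, mul_one]
  rw [hsum] at hb
  set c := ∏ q ∈ T, (1 - 1/(q:ℝ)) with hc
  set M := ∑ n ∈ S, gwa x n with hM
  have hc7 : 1/7 ≤ c := by
    refine le_trans ?_ (gw_prod_ge T (fun q hq => (hTm q hq).1.two_le))
    apply one_div_le_one_div_of_le (by positivity)
    have : (T.card:ℝ) ≤ 6 := by exact_mod_cast hω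
    linarith
  have h63 : ((2:ℝ)^T.card - 1) * B ≤ 63 * B := by
    have : (2:ℝ)^T.card ≤ 2^6 := pow_le_pow_right₀ (by norm_num) hω
    gcongr
    linarith
  have h9 : c * M ≤ 15.625 * 6.47 + c * (63 * B) := by
    have h1 := norm_sub_norm_le ((c:ℂ) * (M:ℂ)) (gwF p ψ S (gwa x) T 1)
    rw [norm_sub_rev] at h1
    have h2 : c * M ≤ ‖(c:ℂ) * (M:ℂ)‖ := by
      rw [← Complex.ofReal_mul, Complex.norm_real]; exact le_abs_self _
    have h3 : c * (((2:ℝ)^T.card - 1) * B) ≤ c * (63 * B) := mul_le_mul_of_nonneg_left h63 (by linarith)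
    linarith
  by_contra hcon
  push Not at hcon
  nlinarith

theorem gw_numeric (p : ℝ) (hp : 2.5 * 10^15 ≤ p) :
    7 * (15.625 * 6.47) + 63 * (29/4 * (Real.log (p / Real.pi) * (1 + 1/10^6) + 10.251)) <
      3.3 * √(√p - 2) - 6.1 * Real.log (√p - 2) := by
  have hp0 : 0 < p := by linarith
  obtain ⟨w, hw, rfl⟩ : ∃ w : ℝ, 0 < w ∧ p = w^4 := by
    refine ⟨√(√p), by positivity, ?_⟩
    rw [show (4:ℕ) = 2*2 by norm_num, pow_mul, Real.sq_sqrt (by positivity), Real.sq_sqrt (by positivity)]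
  have hw1 : 7071 ≤ w := by
    by_contra h
    push Not at h
    have : w^4 < 7071^4 := by gcongr
    linarith
  have e1 : √(w^4) = w^2 := by rw [show w^4 = (w^2)^2 by ring, Real.sqrt_sq (by positivity)]
  rw [e1]
  have hs : 0.9999 * w ≤ √(w^2 - 2) := by
    apply Real.le_sqrt_of_sq_le
    nlinarith
  have hlw : Real.log w ≤ 7.873 + w/7071 := by
    have h6 := Real.log_le_sub_one_of_pos (x := w/7071) (by positivity)
    rw [Real.log_div (by linarith) (by norm_num)] at h6
    have h7 : Real.log (7071^5) ≤ Real.log (2^64) := Real.log_le_log (by norm_num) (by norm_num)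
    rw [Real.log_pow, Real.log_pow] at h7
    have := Real.log_two_lt_d9
    push_cast at h7
    linarith
  have hlw0 : 0 ≤ Real.log w := Real.log_nonneg (by linarith)
  have hl2 : Real.log (w^2 - 2) ≤ 2 * Real.log w := by
    have : Real.log (w^2 - 2) ≤ Real.log (w^2) := Real.log_le_log (by nlinarith) (by linarith)
    rw [Real.log_pow] at this
    exact_mod_cast this
  have hlp : Real.log (w^4 / Real.pi) ≤ 4 * Real.log w - 1 := by
    rw [Real.log_div (by positivity) Real.pi_ne_zero, Real.log_pow]
    have : 1 ≤ Real.log Real.pi := by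
      rw [Real.le_log_iff_exp_le Real.pi_pos]
      linarith [Real.exp_one_lt_d9, Real.pi_gt_three]
    push_cast
    linarith
  linarith

end

/-- Assume GRH. Then `ĝ(p) < √p - 2` for all primes `p ≥ 2.5·10^15` with `ω(p-1) ≤ 6`. -/
theorem grosswald_few_prime_factors (hGRH : GRH) (p : ℕ) (hp : p.Prime)
    (hp' : 2.5 * 10 ^ 15 ≤ (p : ℝ)) (hω : (p - 1).primeFactors.card ≤ 6) :
    (leastPrimePrimitiveRoot p : ℝ) < Real.sqrt p - 2 := by
  by_contra hcon
  push Not at hcon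
  have : Fact p.Prime := ⟨hp⟩
  have : NeZero p := ⟨hp.ne_zero⟩
  have hp4 : 4 ≤ p := by
    have : (4:ℝ) ≤ p := by linarith
    exact_mod_cast this
  have hsq : 4 * 10^7 ≤ √(p:ℝ) := by
    apply Real.le_sqrt_of_sq_le
    linarith
  have hps : √(p:ℝ)^2 = p := Real.sq_sqrt (by positivity)
  set x := √(p:ℝ) - 2 with hx
  have hx7 : 10^7 ≤ x := by linarith
  have hxp : x < p := by nlinarith
  have hnum := gw_numeric p hp'
  rw [← hx] at hnum
  have hpi := Real.pi_pos
  have hα : 0 ≤ Real.log (p/Real.pi) := by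
    apply Real.log_nonneg
    rw [le_div_iff₀ hpi]
    linarith [Real.pi_le_four]
  have hc := gw_combine p hp hω x hx7 hxp (29/4 * (Real.log (p / Real.pi) * (1 + 1/10^6) + 10.251)) (by positivity)
    (by
      intro χ hχ
      have h := gw_F2 p hp4 χ hχ (fun s => hGRH p inferInstance χ s) x hx7
      refine le_trans (le_of_eq ?_) h
      congr 1
      apply Finset.sum_congr rfl
      intro n _
      unfold gwa
      rw [mul_comm])
    (by
      intro q hq ho
      refine hcon.trans ?_
      have : leastPrimePrimitiveRoot p ≤ q := Nat.sInf_le ⟨hq, ho⟩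
      exact_mod_cast this)
  have hm := gw_main x hx7
  unfold gwa at hc
  linarith
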